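/- arXiv:1703.05318 — 2 statements merged into one kernel-verified Lean document; each statement's English description precedes it below -/
import Mathlib

section
/- Let (v; w₀, …, w_{n−1}) be an embedded, immersed simplicial vertex star in ℝ³ with carrier Star = ⋃ᵢ Tᵢ, and let u be a unit vector. Then the orthogonal projection x ↦ x − ⟨x − v, u⟩ u is injective on Star if and only if ⟨mᵢ, u⟩ ≠ 0 for all i and all the numbers ⟨mᵢ, u⟩ (i = 0, …, n−1) have the same sign. (Per-direction form of Proposition 2.13: a direction is transverse exactly when all consistently oriented face normals lie strictly in the open hemisphere determined by it or all in the opposite one.) -/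
open RealInnerProductSpace

noncomputable section

/-- Euclidean 3-space. -/
abbrev E3 : Type := EuclideanSpace ℝ (Fin 3)

/-- The cross product on `E3`. -/
noncomputable def cross3 (a b : E3) : E3 :=
  (WithLp.equiv 2 (Fin 3 → ℝ)).symm
    ![a 1 * b 2 - a 2 * b 1, a 2 * b 0 - a 0 * b 2, a 0 * b 1 - a 1 * b 0]

/-- The face `Tᵢ = conv {v, wᵢ, wᵢ₊₁}` of a simplicial vertex star `(v; w)`;
indices are taken modulo `n`. -/
def starFace {n : ℕ} (v : E3) (w : ZMod n → E3) (i : ZMod n) : Set E3 :=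
  convexHull ℝ {v, w i, w (i + 1)}

/-- The unnormalized face normal `mᵢ = (wᵢ − v) × (wᵢ₊₁ − v)`. -/
noncomputable def starFN {n : ℕ} (v : E3) (w : ZMod n → E3) (i : ZMod n) : E3 :=
  cross3 (w i - v) (w (i + 1) - v)

/-- The unit face normal `nᵢ = mᵢ / ‖mᵢ‖`. -/
noncomputable def starUN {n : ℕ} (v : E3) (w : ZMod n → E3) (i : ZMod n) : E3 :=
  ‖starFN v w i‖⁻¹ • starFN v w i

/-- `(v; w₀, …, w_{n−1})` is an embedded, immersed simplicial vertex star: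
`n ≥ 3`; consecutive edge vectors are linearly independent; distinct faces meet
exactly in their common edge (adjacent case) or in `{v}` (non-adjacent case);
and consecutive unit normals satisfy `nᵢ₊₁ ≠ ±nᵢ`. -/
def IsStar {n : ℕ} (v : E3) (w : ZMod n → E3) : Prop :=
  3 ≤ n ∧
  (∀ i : ZMod n, LinearIndependent ℝ ![w i - v, w (i + 1) - v]) ∧
  (∀ i : ZMod n, starUN v w (i + 1) ≠ starUN v w i ∧ starUN v w (i + 1) ≠ -starUN v w i) ∧
  (∀ i j : ZMod n, i ≠ j →
    (j = i + 1 → starFace v w i ∩ starFace v w j = segment ℝ v (w j)) ∧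
    (i = j + 1 → starFace v w i ∩ starFace v w j = segment ℝ v (w i)) ∧
    (j ≠ i + 1 → i ≠ j + 1 → starFace v w i ∩ starFace v w j = {v}))

/-- The shorter great-circle arc `Arc(p, q)` joining two unit vectors `p ≠ ±q`. -/
def sArc (p q : E3) : Set E3 :=
  {x | ∃ s t : ℝ, 0 ≤ s ∧ 0 ≤ t ∧ 0 < s + t ∧ x = ‖s • p + t • q‖⁻¹ • (s • p + t • q)}

/-- The Gauss image of the vertex star (the spherical polygon with vertices `nᵢ` and
edges `Arc(nᵢ, nᵢ₊₁)`) has no self-intersections. -/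
def GaussEmb {n : ℕ} (v : E3) (w : ZMod n → E3) : Prop :=
  Function.Injective (starUN v w) ∧
  ∀ i j : ZMod n, i ≠ j →
    (j = i + 1 →
      sArc (starUN v w i) (starUN v w (i + 1)) ∩ sArc (starUN v w j) (starUN v w (j + 1)) =
        {starUN v w j}) ∧
    (i = j + 1 →
      sArc (starUN v w i) (starUN v w (i + 1)) ∩ sArc (starUN v w j) (starUN v w (j + 1)) =
        {starUN v w i}) ∧
    (j ≠ i + 1 → i ≠ j + 1 →
      sArc (starUN v w i) (starUN v w (i + 1)) ∩ sArc (starUN v w j) (starUN v w (j + 1)) = ∅)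

/-- The discrete Gaussian curvature (angle defect)
`K(v) = 2π − Σᵢ ∠(wᵢ − v, wᵢ₊₁ − v)`. -/
noncomputable def curv {n : ℕ} [NeZero n] (v : E3) (w : ZMod n → E3) : ℝ :=
  2 * Real.pi - ∑ i : ZMod n, InnerProductGeometry.angle (w i - v) (w (i + 1) - v)

/-- The face `Tᵢ` is an inflection face: its two neighboring faces lie strictly on
opposite sides of its plane. -/
def IsInflectionFace {n : ℕ} (v : E3) (w : ZMod n → E3) (i : ZMod n) : Prop :=
  ⟪w (i - 1) - v, starFN v w i⟫ * ⟪w (i + 2) - v, starFN v w i⟫ < 0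

/-- The carrier `Star = ⋃ᵢ Tᵢ` of the vertex star. -/
def starCarrier {n : ℕ} (v : E3) (w : ZMod n → E3) : Set E3 :=
  ⋃ i : ZMod n, starFace v w i

/-- Triple product. -/
def tr3 (a b c : E3) : ℝ := ⟪cross3 a b, c⟫

lemma tr3_eq (a b c : E3) : tr3 a b c = (a 1 * b 2 - a 2 * b 1) * c 0
    + (a 2 * b 0 - a 0 * b 2) * c 1 + (a 0 * b 1 - a 1 * b 0) * c 2 := by
  simp [tr3, cross3, PiLp.inner_apply, Fin.sum_univ_three]
  ring

lemma tr3_lin1 (s t : ℝ) (a a' b c : E3) :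
    tr3 (s • a + t • a') b c = s * tr3 a b c + t * tr3 a' b c := by
  simp [tr3_eq]; ring

lemma tr3_lin2 (s t : ℝ) (a a' b c : E3) :
    tr3 b (s • a + t • a') c = s * tr3 b a c + t * tr3 b a' c := by
  simp [tr3_eq]; ring

lemma tr3_lin3 (s t : ℝ) (a a' b c : E3) :
    tr3 b c (s • a + t • a') = s * tr3 b c a + t * tr3 b c a' := by
  simp [tr3_eq]; ring

lemma tr3_swap (a b c : E3) : tr3 b a c = - tr3 a b c := by
  simp [tr3_eq]; ring

lemma tr3_11 (a c : E3) : tr3 a a c = 0 := by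
  simp [tr3_eq]; ring

lemma tr3_13 (a c : E3) : tr3 a c a = 0 := by
  simp [tr3_eq]; ring

lemma tr3_23 (a c : E3) : tr3 c a a = 0 := by
  simp [tr3_eq]; ring

lemma tr3_key (a b x u : E3) :
    tr3 a b u • x = tr3 x b u • a + tr3 a x u • b + tr3 a b x • u := by
  ext i
  fin_cases i <;> simp [tr3_eq] <;> ring

lemma tr3_neg (a b c : E3) : tr3 a b (-c) = - tr3 a b c := by
  simp [tr3]

lemma tr3_cont (f g h : ℝ → E3) (hf : Continuous f) (hg : Continuous g) (hh : Continuous h) :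
    Continuous fun t => tr3 (f t) (g t) (h t) := by
  simp only [tr3_eq]
  fun_prop

/-- The projection of `x` along `u` lies in the projected cone `j`. -/
def InCone {n : ℕ} (a : ZMod n → E3) (u : E3) (j : ZMod n) (x : E3) : Prop :=
  0 ≤ tr3 (a j) x u ∧ 0 ≤ tr3 x (a (j + 1)) u

/-- `x` lies strictly below the star in direction `u`. -/
def Below {n : ℕ} (a : ZMod n → E3) (u : E3) (x : E3) : Prop :=
  ∃ j, InCone a u j x ∧ tr3 (a j) (a (j + 1)) x < 0

lemma zmod_all {n : ℕ} [NeZero n] (P : ZMod n → Prop) (h : ∀ i, P i → P (i + 1))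
    (i j : ZMod n) (hi : P i) : P j := by
  have : ∀ k : ℕ, P (i + k) := by
    intro k
    induction k with
    | zero => simpa using hi
    | succ k ih => have := h _ ih; push_cast; rwa [← add_assoc]
  have h2 := this (j - i).val
  rw [ZMod.natCast_zmod_val] at h2
  simpa using h2

section
variable {n : ℕ} [NeZero n] (a : ZMod n → E3) (u : E3)

lemma below_scale (c : ℝ) (hc : 0 < c) (x : E3) : Below a u (c • x) ↔ Below a u x := by
  have h1 : ∀ j, tr3 (a j) (c • x) u = c * tr3 (a j) x u := fun j => by simp [tr3_eq]; ring
  have h2 : ∀ j, tr3 (c • x) (a j) u = c * tr3 x (a j) u := fun j => by simp [tr3_eq]; ring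
  have h3 : ∀ i j, tr3 (a i) (a j) (c • x) = c * tr3 (a i) (a j) x :=
    fun i j => by simp [tr3_eq]; ring
  have h4 : ∀ y : ℝ, c * y < 0 ↔ y < 0 := fun y => by
    constructor
    · intro h; by_contra h'; push Not at h'; have := mul_nonneg hc.le h'; linarith
    · intro h; exact mul_neg_of_pos_of_neg hc h
  unfold Below InCone
  simp only [h1, h2, h3, mul_nonneg_iff_of_pos_left hc, h4]

lemma below_open (hpos : ∀ i, 0 < tr3 (a i) (a (i + 1)) u) (f : ℝ → E3) (hf : Continuous f)
    (hnz : ∀ t, ∀ r : ℝ, f t ≠ r • u) : IsOpen {t | Below a u (f t)} := by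
  rw [isOpen_iff_mem_nhds]
  rintro t ⟨j, ⟨h1, h2⟩, h3⟩
  have c1 : ∀ j, Continuous fun t => tr3 (a j) (f t) u := fun j =>
    tr3_cont _ _ _ continuous_const hf continuous_const
  have c2 : ∀ j, Continuous fun t => tr3 (f t) (a j) u := fun j =>
    tr3_cont _ _ _ hf continuous_const continuous_const
  have c3 : ∀ i j, Continuous fun t => tr3 (a i) (a j) (f t) := fun i j =>
    tr3_cont _ _ _ continuous_const continuous_const hf
  have e3 := (isOpen_lt (c3 j (j + 1)) continuous_const).mem_nhds h3
  have key := tr3_key (a j) (a (j + 1)) (f t) u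
  have hj := hpos j
  rcases h1.lt_or_eq with h1 | h1
  · have e1 := (isOpen_lt continuous_const (c1 j)).mem_nhds h1
    rcases h2.lt_or_eq with h2 | h2
    · have e2 := (isOpen_lt continuous_const (c2 (j + 1))).mem_nhds h2
      filter_upwards [e1, e2, e3] with t' g1 g2 g3
      exact ⟨j, ⟨le_of_lt g1, le_of_lt g2⟩, g3⟩
    · -- on the ray j+1
      have hj' := hpos (j + 1)
      have k1 : tr3 (a j) (a (j + 1)) u * tr3 (f t) (a (j + 1 + 1)) u
          = tr3 (a j) (f t) u * tr3 (a (j + 1)) (a (j + 1 + 1)) u := by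
        have := congrArg (fun y => tr3 y (a (j + 1 + 1)) u) key
        simp only [← h2] at this
        simp [tr3_eq] at this ⊢
        linarith
      have k2 : tr3 (a j) (a (j + 1)) u * tr3 (a (j + 1)) (a (j + 1 + 1)) (f t)
          = tr3 (a j) (a (j + 1)) (f t) * tr3 (a (j + 1)) (a (j + 1 + 1)) u := by
        have := congrArg (fun y => tr3 (a (j + 1)) (a (j + 1 + 1)) y) key
        simp only [← h2] at this
        simp [tr3_eq] at this ⊢
        linarith
      have p1 : 0 < tr3 (f t) (a (j + 1 + 1)) u := by
        have := mul_pos h1 hj'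
        rw [← k1] at this
        exact (mul_pos_iff_of_pos_left hj).1 this
      have p2 : tr3 (a (j + 1)) (a (j + 1 + 1)) (f t) < 0 := by
        have := mul_neg_of_neg_of_pos h3 hj'
        rw [← k2] at this
        exact (pos_iff_neg_of_mul_neg this).1 hj
      have e4 := (isOpen_lt continuous_const (c2 (j + 1 + 1))).mem_nhds p1
      have e5 := (isOpen_lt (c3 (j + 1) (j + 1 + 1)) continuous_const).mem_nhds p2
      filter_upwards [e1, e3, e4, e5] with t' g1 g3 g4 g5
      rcases le_total 0 (tr3 (f t') (a (j + 1)) u) with g | g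
      · exact ⟨j, ⟨le_of_lt g1, g⟩, g3⟩
      · refine ⟨j + 1, ⟨?_, le_of_lt g4⟩, g5⟩
        rw [tr3_swap]; linarith
  · rcases h2.lt_or_eq with h2 | h2
    · have e2 := (isOpen_lt continuous_const (c2 (j + 1))).mem_nhds h2
      have hj' := hpos (j - 1)
      have hjj : j - 1 + 1 = j := by ring
      rw [hjj] at hj'
      have k1 : tr3 (a j) (a (j + 1)) u * tr3 (a (j - 1)) (f t) u
          = tr3 (f t) (a (j + 1)) u * tr3 (a (j - 1)) (a j) u := by
        have := congrArg (fun y => tr3 (a (j - 1)) y u) key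
        simp only [← h1] at this
        simp [tr3_eq] at this ⊢
        linarith
      have k2 : tr3 (a j) (a (j + 1)) u * tr3 (a (j - 1)) (a j) (f t)
          = tr3 (a j) (a (j + 1)) (f t) * tr3 (a (j - 1)) (a j) u := by
        have := congrArg (fun y => tr3 (a (j - 1)) (a j) y) key
        simp only [← h1] at this
        simp [tr3_eq] at this ⊢
        linarith
      have p1 : 0 < tr3 (a (j - 1)) (f t) u := by
        have := mul_pos h2 hj'
        rw [← k1] at this
        exact (mul_pos_iff_of_pos_left hj).1 this
      have p2 : tr3 (a (j - 1)) (a j) (f t) < 0 := by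
        have := mul_neg_of_neg_of_pos h3 hj'
        rw [← k2] at this
        exact (pos_iff_neg_of_mul_neg this).1 hj
      have e4 := (isOpen_lt continuous_const (c1 (j - 1))).mem_nhds p1
      have e5 := (isOpen_lt (c3 (j - 1) j) continuous_const).mem_nhds p2
      filter_upwards [e2, e3, e4, e5] with t' g1 g3 g4 g5
      rcases le_total 0 (tr3 (a j) (f t') u) with g | g
      · exact ⟨j, ⟨g, le_of_lt g1⟩, g3⟩
      · refine ⟨j - 1, ⟨le_of_lt g4, ?_⟩, ?_⟩
        · rw [hjj, tr3_swap]; linarith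
        · rw [hjj]; exact g5
    · exfalso
      rw [← h1, ← h2] at key
      refine hnz t ((tr3 (a j) (a (j + 1)) u)⁻¹ * tr3 (a j) (a (j + 1)) (f t)) ?_
      rw [mul_smul]
      rw [zero_smul, zero_smul, zero_add, zero_add] at key
      rw [← key, smul_smul, inv_mul_cancel₀ hj.ne', one_smul]

lemma path_nz (b c : E3) (h : 0 < tr3 b c u) (s t : ℝ) (hst : s ≠ 0 ∨ t ≠ 0) (r : ℝ) :
    s • b + t • c ≠ r • u := by
  intro he
  have h1 := congrArg (fun y => tr3 b y u) he
  have h2 := congrArg (fun y => tr3 y c u) he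
  have k1 : t * tr3 b c u = 0 := by
    simp only [tr3_eq, PiLp.add_apply, PiLp.smul_apply, smul_eq_mul] at h1 ⊢; linarith
  have k2 : s * tr3 b c u = 0 := by
    simp only [tr3_eq, PiLp.add_apply, PiLp.smul_apply, smul_eq_mul] at h2 ⊢; linarith
  rcases hst with h' | h'
  · exact (mul_ne_zero h' h.ne') k2
  · exact (mul_ne_zero h' h.ne') k1

/-- Abstract non-adjacent embeddedness. -/
def NonAdjEmb {n : ℕ} (a : ZMod n → E3) : Prop :=
  ∀ i j : ZMod n, i ≠ j → j ≠ i + 1 → i ≠ j + 1 → ∀ s t s' t' : ℝ, 0 ≤ s → 0 ≤ t → 0 ≤ s' →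
    0 ≤ t' → s • a i + t • a (i + 1) = s' • a j + t' • a (j + 1) → s • a i + t • a (i + 1) = 0

lemma below_closed (hpos : ∀ i, 0 < tr3 (a i) (a (i + 1)) u) (hemb : NonAdjEmb a) (i : ZMod n) :
    IsClosed {t : ℝ | t ∈ Set.Icc (0 : ℝ) 1 ∧
      Below a u ((1 - t) • a i + t • a (i + 1))} := by
  set f : ℝ → E3 := fun t => (1 - t) • a i + t • a (i + 1) with hfdef
  have hf : Continuous f := by fun_prop
  have c1 : ∀ j, Continuous fun t => tr3 (a j) (f t) u := fun j =>
    tr3_cont _ _ _ continuous_const hf continuous_const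
  have c2 : ∀ j, Continuous fun t => tr3 (f t) (a j) u := fun j =>
    tr3_cont _ _ _ hf continuous_const continuous_const
  have c3 : ∀ i j, Continuous fun t => tr3 (a i) (a j) (f t) := fun i j =>
    tr3_cont _ _ _ continuous_const continuous_const hf
  have hi := hpos i
  have : {t : ℝ | t ∈ Set.Icc (0 : ℝ) 1 ∧ Below a u (f t)} =
      ⋃ j : ZMod n, {t : ℝ | t ∈ Set.Icc (0 : ℝ) 1 ∧ InCone a u j (f t) ∧
        tr3 (a j) (a (j + 1)) (f t) < 0} := by
    ext t
    simp [Below]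
  change IsClosed {t : ℝ | t ∈ Set.Icc (0 : ℝ) 1 ∧ Below a u (f t)}
  rw [this]
  refine isClosed_iUnion_of_finite fun j => ?_
  by_cases h0 : i = j
  · convert isClosed_empty
    subst h0
    rw [Set.eq_empty_iff_forall_notMem]
    rintro t ⟨-, -, h⟩
    simp only [hfdef, tr3_lin3, tr3_13, tr3_23] at h
    linarith
  by_cases h1 : j = i + 1
  · convert isClosed_empty
    subst h1
    rw [Set.eq_empty_iff_forall_notMem]
    rintro t ⟨ht, ⟨h, -⟩, h'⟩
    simp only [hfdef, tr3_lin2, tr3_11] at h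
    rw [tr3_swap] at h
    have ht1 : t = 1 := by
      by_contra hne
      have : 0 < 1 - t := by
        rcases lt_or_eq_of_le ht.2 with h | h
        · linarith
        · exact absurd h hne
      nlinarith [mul_pos this hi]
    subst ht1
    simp only [hfdef, tr3_lin3, tr3_13] at h'
    norm_num at h'
  by_cases h2 : i = j + 1
  · convert isClosed_empty
    rw [Set.eq_empty_iff_forall_notMem]
    rintro t ⟨ht, ⟨-, h⟩, h'⟩
    rw [← h2] at h h'
    simp only [hfdef, tr3_lin1, tr3_11] at h
    rw [tr3_swap] at h
    have ht1 : t = 0 := by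
      by_contra hne
      have : 0 < t := lt_of_le_of_ne ht.1 (Ne.symm hne)
      nlinarith [mul_pos this hi]
    subst ht1
    simp only [hfdef, tr3_lin3, tr3_23] at h'
    norm_num at h'
  have hh : {t : ℝ | t ∈ Set.Icc (0 : ℝ) 1 ∧ InCone a u j (f t) ∧
        tr3 (a j) (a (j + 1)) (f t) < 0} = Set.Icc (0 : ℝ) 1 ∩ ({t : ℝ | 0 ≤ tr3 (a j) (f t) u} ∩
        ({t : ℝ | 0 ≤ tr3 (f t) (a (j + 1)) u} ∩ {t : ℝ | tr3 (a j) (a (j + 1)) (f t) ≤ 0})) := by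
    ext t
    constructor
    · rintro ⟨g0, ⟨g1, g2⟩, g3⟩
      exact ⟨g0, g1, g2, le_of_lt g3⟩
    · rintro ⟨g0, g1, g2, g3⟩
      refine ⟨g0, ⟨g1, g2⟩, lt_of_le_of_ne g3 fun g4 => ?_⟩
      have key := tr3_key (a j) (a (j + 1)) (f t) u
      rw [g4, zero_smul, add_zero] at key
      have hj := hpos j
      have := hemb i j h0 h1 h2 (tr3 (a j) (a (j + 1)) u * (1 - t)) (tr3 (a j) (a (j + 1)) u * t)
        (tr3 (f t) (a (j + 1)) u) (tr3 (a j) (f t) u) (mul_nonneg hj.le (by linarith [g0.2]))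
        (mul_nonneg hj.le g0.1) g2 g1 (by rw [← key]; simp [hfdef, smul_smul])
      refine path_nz u (a i) (a (i + 1)) hi _ _ ?_ 0 (by rw [this, zero_smul])
      rcases eq_or_ne t 0 with h | h
      · left; subst h; simpa using hj.ne'
      · right; exact mul_ne_zero hj.ne' h
  rw [hh]
  exact isClosed_Icc.inter ((isClosed_le continuous_const (c1 j)).inter
    ((isClosed_le continuous_const (c2 _)).inter (isClosed_le (c3 _ _) continuous_const)))

lemma below_seg (hpos : ∀ i, 0 < tr3 (a i) (a (i + 1)) u) (hemb : NonAdjEmb a) (i : ZMod n)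
    (t t' : ℝ) (ht : t ∈ Set.Icc (0 : ℝ) 1) (ht' : t' ∈ Set.Icc (0 : ℝ) 1)
    (h : Below a u ((1 - t) • a i + t • a (i + 1))) :
    Below a u ((1 - t') • a i + t' • a (i + 1)) := by
  have ho := below_open a u hpos (fun t => (1 - t) • a i + t • a (i + 1)) (by fun_prop)
    (fun t r => path_nz u _ _ (hpos i) _ _ (by
      rcases eq_or_ne t 0 with h | h
      · left; subst h; simp
      · right; exact h) r)
  have hc := below_closed a u hpos hemb i
  have hcl : IsClopen {t : Set.Icc (0 : ℝ) 1 |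
      Below a u ((1 - (t : ℝ)) • a i + (t : ℝ) • a (i + 1))} := by
    constructor
    · have := hc.preimage (continuous_subtype_val (p := fun t => t ∈ Set.Icc (0 : ℝ) 1))
      convert this using 1
      ext t
      simp only [Set.mem_ofPred_eq, Set.mem_preimage]
      exact ⟨fun h => ⟨t.2, h⟩, fun h => h.2⟩
    · exact ho.preimage continuous_subtype_val
  rcases isClopen_iff.1 hcl with h1 | h1
  · have h2 : (⟨t, ht⟩ : Set.Icc (0 : ℝ) 1) ∈ {t : Set.Icc (0 : ℝ) 1 |
      Below a u ((1 - (t : ℝ)) • a i + (t : ℝ) • a (i + 1))} := h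
    rw [h1] at h2
    exact absurd h2 (Set.notMem_empty _)
  · have : (⟨t', ht'⟩ : Set.Icc (0 : ℝ) 1) ∈ {t : Set.Icc (0 : ℝ) 1 |
      Below a u ((1 - (t : ℝ)) • a i + (t : ℝ) • a (i + 1))} := by rw [h1]; trivial
    exact this

lemma below_cone (hpos : ∀ i, 0 < tr3 (a i) (a (i + 1)) u) (hemb : NonAdjEmb a) (i : ZMod n)
    (s t : ℝ) (hs : 0 ≤ s) (ht : 0 ≤ t) (hst : 0 < s + t) :
    Below a u (s • a i + t • a (i + 1)) ↔ Below a u (a i) := by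
  have e : s • a i + t • a (i + 1) =
      (s + t) • ((1 - t / (s + t)) • a i + (t / (s + t)) • a (i + 1)) := by
    rw [smul_add, smul_smul, smul_smul]
    congr 2 <;> field_simp
    ring
  rw [e, below_scale a u _ hst]
  have m : t / (s + t) ∈ Set.Icc (0 : ℝ) 1 :=
    ⟨by positivity, by rw [div_le_one hst]; linarith⟩
  have m0 : (0 : ℝ) ∈ Set.Icc (0 : ℝ) 1 := by simp
  constructor
  · intro h
    simpa using below_seg a u hpos hemb i _ 0 m m0 h
  · intro h
    exact below_seg a u hpos hemb i 0 _ m0 m (by simpa using h)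

lemma not_below (hpos : ∀ i, 0 < tr3 (a i) (a (i + 1)) u) (hemb : NonAdjEmb a) (i : ZMod n) :
    ¬ Below a u (a i) := by
  intro hi
  have hall : ∀ j, Below a u (a j) := fun j => zmod_all (fun j => Below a u (a j))
    (fun k hk => by
      have := (below_cone a u hpos hemb k 0 1 le_rfl zero_le_one (by norm_num)).2 hk
      simpa using this) i j hi
  classical
  obtain ⟨j, hj, hmax⟩ := Finset.exists_max_image
    (Finset.univ.filter fun j => InCone a u j (a i))
    (fun j => - tr3 (a j) (a (j + 1)) (a i) / tr3 (a j) (a (j + 1)) u)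
    ⟨i, Finset.mem_filter.2 ⟨Finset.mem_univ _, by rw [tr3_11], (hpos i).le⟩⟩
  simp only [Finset.mem_filter, Finset.mem_univ, true_and] at hj hmax
  set r := - tr3 (a j) (a (j + 1)) (a i) / tr3 (a j) (a (j + 1)) u with hr
  have hD := hpos j
  have hnz : 0 < tr3 (a i) (a (j + 1)) u + tr3 (a j) (a i) u := by
    rcases (add_nonneg hj.2 hj.1).lt_or_eq with h | h
    · exact h
    · exfalso
      have z1 : tr3 (a i) (a (j + 1)) u = 0 := by linarith [hj.1, hj.2]
      have z2 : tr3 (a j) (a i) u = 0 := by linarith [hj.1, hj.2]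
      have key := tr3_key (a j) (a (j + 1)) (a i) u
      rw [z1, z2, zero_smul, zero_smul, zero_add, zero_add] at key
      refine path_nz u (a i) (a (i + 1)) (hpos i) (tr3 (a j) (a (j + 1)) u) 0
        (Or.inl hD.ne') (tr3 (a j) (a (j + 1)) (a i)) ?_
      rw [zero_smul, add_zero]; exact key
  have hb := (below_cone a u hpos hemb j _ _ hj.2 hj.1 hnz).2 (hall j)
  have key := tr3_key (a j) (a (j + 1)) (a i) u
  have e : tr3 (a i) (a (j + 1)) u • a j + tr3 (a j) (a i) u • a (j + 1)
      = tr3 (a j) (a (j + 1)) u • ((1 : ℝ) • a i + r • u) := by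
    rw [smul_add, one_smul, key, smul_smul, hr, mul_div_cancel₀ _ hD.ne', neg_smul]
    abel
  rw [e, below_scale a u _ hD] at hb
  obtain ⟨k, ⟨g1, g2⟩, g3⟩ := hb
  rw [tr3_lin2, tr3_23] at g1
  rw [tr3_lin1, tr3_13] at g2
  rw [tr3_lin3] at g3
  have := hmax k ⟨by linarith, by linarith⟩
  rw [div_le_iff₀ (hpos k)] at this
  linarith

lemma same_height (hpos : ∀ i, 0 < tr3 (a i) (a (i + 1)) u) (hemb : NonAdjEmb a) (i j : ZMod n)
    (s t s' t' r : ℝ) (hs : 0 ≤ s) (ht : 0 ≤ t) (hs' : 0 ≤ s') (ht' : 0 ≤ t')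
    (h : s' • a j + t' • a (j + 1) = (s • a i + t • a (i + 1)) + r • u) : r ≤ 0 := by
  by_contra hr
  push Not at hr
  rcases (add_nonneg hs ht).lt_or_eq with hst | hst
  · refine not_below a u hpos hemb i
      ((below_cone a u hpos hemb i s t hs ht hst).1 ⟨j, ⟨?_, ?_⟩, ?_⟩)
    · have := congrArg (fun y => tr3 (a j) y u) h
      have h0 := mul_nonneg ht' (hpos j).le
      simp [tr3_eq] at this h0 ⊢; linarith
    · have := congrArg (fun y => tr3 y (a (j + 1)) u) h
      have h0 := mul_nonneg hs' (hpos j).le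
      simp [tr3_eq] at this h0 ⊢; linarith
    · have := congrArg (fun y => tr3 (a j) (a (j + 1)) y) h
      have h0 := mul_pos hr (hpos j)
      simp [tr3_eq] at this h0 ⊢; linarith
  · have z1 : s = 0 := by linarith
    have z2 : t = 0 := by linarith
    subst z1 z2
    rw [zero_smul, zero_smul, zero_add, zero_add] at h
    have hu0 : u ≠ 0 := by
      rintro rfl
      have := hpos i
      simp [tr3_eq] at this
    by_cases hne : s' ≠ 0 ∨ t' ≠ 0
    · exact path_nz u _ _ (hpos j) s' t' hne r h
    · push Not at hne
      rw [hne.1, hne.2, zero_smul, zero_smul, zero_add] at h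
      have := (smul_eq_zero.1 h.symm)
      rcases this with h | h
      · linarith
      · exact hu0 h

end

lemma mem_face {n : ℕ} (v : E3) (w : ZMod n → E3) (i : ZMod n) (x : E3) :
    x ∈ starFace v w i ↔ ∃ s t : ℝ, 0 ≤ s ∧ 0 ≤ t ∧ s + t ≤ 1 ∧
      x = v + (s • (w i - v) + t • (w (i + 1) - v)) := by
  unfold starFace
  rw [convexHull_insert (by simp), convexHull_pair]
  simp only [segment_eq_image, mem_convexJoin, Set.mem_singleton_iff, exists_eq_left,
    Set.mem_image]
  constructor
  · rintro ⟨_, ⟨p, ⟨hp0, hp1⟩, rfl⟩, q, ⟨hq0, hq1⟩, rfl⟩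
    refine ⟨q * (1 - p), q * p, mul_nonneg hq0 (by linarith), mul_nonneg hq0 hp0,
      by nlinarith, ?_⟩
    module
  · rintro ⟨s, t, hs, ht, hst, rfl⟩
    rcases (add_nonneg hs ht).lt_or_eq with h | h
    · refine ⟨_, ⟨t / (s + t), ⟨by positivity, by rw [div_le_one h]; linarith⟩, rfl⟩, s + t,
        ⟨h.le, hst⟩, ?_⟩
      have e : ∀ y z : E3, (s + t) • ((1 - t / (s + t)) • y + (t / (s + t)) • z)
          = s • y + t • z := by
        intro y z
        rw [smul_add, smul_smul, smul_smul]
        congr 2 <;> field_simp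
        ring
      rw [e]
      module
    · have z1 : s = 0 := by linarith
      have z2 : t = 0 := by linarith
      subst z1 z2
      exact ⟨_, ⟨0, by simp, rfl⟩, 0, by simp, by simp⟩

lemma nonadj_of_star {n : ℕ} (v : E3) (w : ZMod n → E3) (hstar : IsStar v w) :
    NonAdjEmb (fun i => w i - v) := by
  intro i j h0 h1 h2 s t s' t' hs ht hs' ht' he
  have hf := (hstar.2.2.2 i j h0).2.2 h1 h2
  set c := (s + t + s' + t' + 1)⁻¹ with hc
  have hcp : 0 < c := by positivity
  have hM : c * (s + t + s' + t' + 1) = 1 := inv_mul_cancel₀ (by positivity)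
  have m1 : v + c • (s • (w i - v) + t • (w (i + 1) - v)) ∈ starFace v w i := by
    rw [mem_face]
    exact ⟨c * s, c * t, by positivity, by positivity,
      by nlinarith [mul_nonneg hcp.le hs', mul_nonneg hcp.le ht'],
      by rw [smul_add, smul_smul, smul_smul]⟩
  have m2 : v + c • (s • (w i - v) + t • (w (i + 1) - v)) ∈ starFace v w j := by
    rw [mem_face]
    exact ⟨c * s', c * t', by positivity, by positivity,
      by nlinarith [mul_nonneg hcp.le hs, mul_nonneg hcp.le ht],
      by rw [he, smul_add, smul_smul, smul_smul]⟩
  have : v + c • (s • (w i - v) + t • (w (i + 1) - v)) ∈ ({v} : Set E3) := by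
    rw [← hf]; exact ⟨m1, m2⟩
  have h3 := add_eq_left.1 (Set.mem_singleton_iff.1 this)
  exact (smul_eq_zero.1 h3).resolve_left hcp.ne'

lemma inj_of_pos {n : ℕ} [NeZero n] (v : E3) (w : ZMod n → E3) (hstar : IsStar v w)
    (u : E3) (hpos : ∀ i : ZMod n, 0 < ⟪starFN v w i, u⟫) :
    Set.InjOn (fun x : E3 => x - ⟪x - v, u⟫ • u) (starCarrier v w) := by
  have hemb := nonadj_of_star v w hstar
  intro x hx y hy hxy
  simp only [starCarrier, Set.mem_iUnion, mem_face] at hx hy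
  obtain ⟨i, s, t, hs, ht, -, hx⟩ := hx
  obtain ⟨j, s', t', hs', ht', -, hy⟩ := hy
  simp only at hxy
  set r := ⟪y - v, u⟫ - ⟪x - v, u⟫ with hr
  have hyx : y = x + r • u := by
    have : y = x - ⟪x - v, u⟫ • u + ⟪y - v, u⟫ • u := by rw [hxy]; abel
    rw [this, hr, sub_smul]; abel
  have e1 : s' • (w j - v) + t' • (w (j + 1) - v)
      = (s • (w i - v) + t • (w (i + 1) - v)) + r • u := by
    have := hyx
    rw [hx, hy, add_assoc] at this
    exact add_left_cancel this
  have r1 := same_height (fun i => w i - v) u hpos hemb i j s t s' t' r hs ht hs' ht' e1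
  have r2 := same_height (fun i => w i - v) u hpos hemb j i s' t' s t (-r) hs' ht' hs ht
    (by rw [e1]; module)
  have : r = 0 := by linarith
  rw [hyx, this, zero_smul, add_zero]

lemma proj_eq (v u : E3) (hu : ‖u‖ = 1) (x y : E3) (r : ℝ) (h : y = x + r • u) :
    y - ⟪y - v, u⟫ • u = x - ⟪x - v, u⟫ • u := by
  have : ⟪y - v, u⟫ = ⟪x - v, u⟫ + r := by
    rw [h, add_sub_right_comm, inner_add_left, real_inner_smul_left, real_inner_self_eq_norm_sq, hu]
    ring
  rw [this, h]
  module

lemma cross_ne {n : ℕ} (v : E3) (w : ZMod n → E3) (hstar : IsStar v w) (i : ZMod n) :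
    starFN v w i ≠ 0 := by
  intro h
  have hl := LinearIndependent.pair_iff.1 (hstar.2.1 i)
  have hz : ∀ c, tr3 (w i - v) (w (i + 1) - v) c = 0 := by
    intro c
    change ⟪starFN v w i, c⟫ = 0
    rw [h, inner_zero_left]
  have key : ∀ c d, tr3 c (w (i + 1) - v) d • (w i - v) + tr3 (w i - v) c d • (w (i + 1) - v)
      = 0 := by
    intro c d
    have := tr3_key (w i - v) (w (i + 1) - v) c d
    rw [hz, hz, zero_smul, zero_smul, add_zero] at this
    exact this.symm
  have hz2 : ∀ c d, tr3 c (w (i + 1) - v) d = 0 := fun c d => (hl _ _ (key c d)).1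
  have hb : w (i + 1) - v = 0 := by
    set b := w (i + 1) - v
    have q0 := hz2 (!₂[0, 1, 0]) (!₂[1, 0, 0])
    have q1 := hz2 (!₂[0, 1, 0]) (!₂[0, 0, 1])
    have q2 := hz2 (!₂[1, 0, 0]) (!₂[0, 0, 1])
    simp [tr3_eq] at q0 q1 q2
    ext k
    fin_cases k
    · simpa using q1
    · simpa using q2
    · simpa using q0
  have := hl 0 1 (by rw [hb]; simp)
  exact one_ne_zero this.2

lemma ne_of_inj {n : ℕ} (v : E3) (w : ZMod n → E3) (hstar : IsStar v w)
    (u : E3) (hu : ‖u‖ = 1)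
    (hinj : Set.InjOn (fun x : E3 => x - ⟪x - v, u⟫ • u) (starCarrier v w)) (i : ZMod n) :
    ⟪starFN v w i, u⟫ ≠ 0 := by
  intro h
  have hm := cross_ne v w hstar i
  have hT : 0 < tr3 (w i - v) (w (i + 1) - v) (starFN v w i) := real_inner_self_pos.2 hm
  have key := tr3_key (w i - v) (w (i + 1) - v) (starFN v w i) u
  have h' : tr3 (w i - v) (w (i + 1) - v) u = 0 := h
  rw [h', zero_smul] at key
  set T := tr3 (w i - v) (w (i + 1) - v) (starFN v w i)
  set P := tr3 (starFN v w i) (w (i + 1) - v) u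
  set Q := tr3 (w i - v) (starFN v w i) u
  set ε := (6 * (|P| + |Q| + 1))⁻¹ with hε
  have hεp : 0 < ε := by positivity
  have hM : ε * (6 * (|P| + |Q| + 1)) = 1 := inv_mul_cancel₀ (by positivity)
  have b1 : |ε * P| ≤ 1 / 6 := by
    rw [abs_mul, abs_of_pos hεp]; nlinarith [mul_nonneg hεp.le (abs_nonneg Q)]
  have b2 : |ε * Q| ≤ 1 / 6 := by
    rw [abs_mul, abs_of_pos hεp]; nlinarith [mul_nonneg hεp.le (abs_nonneg P)]
  rw [abs_le] at b1 b2
  have m1 : v + ((1 / 3 : ℝ) • (w i - v) + (1 / 3 : ℝ) • (w (i + 1) - v)) ∈ starCarrier v w := by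
    refine Set.mem_iUnion.2 ⟨i, (mem_face _ _ _ _).2 ⟨_, _, ?_, ?_, ?_, rfl⟩⟩ <;> norm_num
  have m2 : v + ((1 / 3 + ε * P : ℝ) • (w i - v) + (1 / 3 + ε * Q : ℝ) • (w (i + 1) - v))
      ∈ starCarrier v w := by
    refine Set.mem_iUnion.2 ⟨i, (mem_face _ _ _ _).2 ⟨_, _, ?_, ?_, ?_, rfl⟩⟩ <;> linarith
  have e : v + ((1 / 3 + ε * P : ℝ) • (w i - v) + (1 / 3 + ε * Q : ℝ) • (w (i + 1) - v))
      = v + ((1 / 3 : ℝ) • (w i - v) + (1 / 3 : ℝ) • (w (i + 1) - v)) + (-(ε * T)) • u := by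
    have k2 : (ε * T) • u = - (ε • (P • (w i - v) + Q • (w (i + 1) - v))) := by
      rw [mul_smul, ← smul_neg]
      congr 1
      rw [eq_neg_iff_add_eq_zero, key]; abel
    rw [neg_smul, k2]
    module
  have := hinj m2 m1 (proj_eq v u hu _ _ _ e)
  rw [this] at e
  have e2 := left_eq_add.1 e
  rcases smul_eq_zero.1 e2 with h | h
  · have := mul_pos hεp hT; linarith
  · rw [h] at hu; simp at hu

lemma pos_step {n : ℕ} (v : E3) (w : ZMod n → E3) (hstar : IsStar v w)
    (u : E3) (hu : ‖u‖ = 1)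
    (hinj : Set.InjOn (fun x : E3 => x - ⟪x - v, u⟫ • u) (starCarrier v w)) (i : ZMod n)
    (h : 0 < ⟪starFN v w i, u⟫) : 0 < ⟪starFN v w (i + 1), u⟫ := by
  by_contra hneg
  have hneg := lt_of_le_of_ne (not_lt.1 hneg) (ne_of_inj v w hstar u hu hinj (i + 1))
  have hi1 : i ≠ i + 1 := by
    have : Fact (1 < n) := ⟨by have := hstar.1; omega⟩
    intro h
    exact one_ne_zero (left_eq_add.1 h)
  have hcap := (hstar.2.2.2 i (i + 1) hi1).1 rfl
  have hl := LinearIndependent.pair_iff.1 (hstar.2.1 (i + 1))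
  have hP : 0 < tr3 (w i - v) (w (i + 1) - v) u := h
  have hQ : tr3 (w (i + 1) - v) (w (i + 1 + 1) - v) u < 0 := hneg
  rw [tr3_swap] at hQ
  have key := tr3_key (w i - v) (w (i + 1) - v) (w (i + 1 + 1) - v) u
  set P := tr3 (w i - v) (w (i + 1) - v) u
  set Q := tr3 (w (i + 1 + 1) - v) (w (i + 1) - v) u
  set R := tr3 (w i - v) (w (i + 1 + 1) - v) u
  set T := tr3 (w i - v) (w (i + 1) - v) (w (i + 1 + 1) - v)
  have hQ : 0 < Q := by linarith
  set c := (P + Q + |R| + |R| + 1)⁻¹ with hc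
  have hR := abs_nonneg R
  have hRR := neg_abs_le R
  have hRR' := le_abs_self R
  have hcp : 0 < c := by positivity
  have hM : c * (P + Q + |R| + |R| + 1) = 1 := inv_mul_cancel₀ (by positivity)
  have m1 : v + ((c * Q) • (w i - v) + (c * (R + |R|)) • (w (i + 1) - v)) ∈ starFace v w i := by
    refine (mem_face _ _ _ _).2 ⟨_, _, by positivity, mul_nonneg hcp.le (by linarith), ?_, rfl⟩
    rw [← hM, ← mul_add]
    exact mul_le_mul_of_nonneg_left (by linarith) hcp.le
  have m2 : v + ((c * |R|) • (w (i + 1) - v) + (c * P) • (w (i + 1 + 1) - v))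
      ∈ starFace v w (i + 1) := by
    refine (mem_face _ _ _ _).2 ⟨_, _, by positivity, by positivity, ?_, rfl⟩
    rw [← hM, ← mul_add]
    exact mul_le_mul_of_nonneg_left (by linarith) hcp.le
  have e : v + ((c * |R|) • (w (i + 1) - v) + (c * P) • (w (i + 1 + 1) - v)) =
      v + ((c * Q) • (w i - v) + (c * (R + |R|)) • (w (i + 1) - v)) + (c * T) • u := by
    rw [mul_smul c P, key]
    module
  have he := hinj (Set.mem_iUnion.2 ⟨_, m2⟩) (Set.mem_iUnion.2 ⟨_, m1⟩) (proj_eq v u hu _ _ _ e)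
  rw [← he] at m1
  have : v + ((c * |R|) • (w (i + 1) - v) + (c * P) • (w (i + 1 + 1) - v))
      ∈ segment ℝ v (w (i + 1)) := by rw [← hcap]; exact ⟨m1, m2⟩
  rw [segment_eq_image] at this
  obtain ⟨q, -, hq⟩ := this
  simp only at hq
  have h0 : (c * |R| - q) • (w (i + 1) - v) + (c * P) • (w (i + 1 + 1) - v) = 0 := by
    have h1 : (1 - q) • v + q • w (i + 1) = v + q • (w (i + 1) - v) := by module
    rw [h1] at hq
    have h2 := add_left_cancel hq
    rw [sub_smul, h2]
    abel
  have := (hl _ _ h0).2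
  have := mul_pos hcp hP
  linarith

/-- Per-direction form of Proposition 2.13: for an embedded, immersed simplicial vertex
star and a unit vector `u`, orthogonal projection along `u` is injective on the carrier
of the star if and only if all the numbers `⟨mᵢ, u⟩` are nonzero and of the same sign. -/
theorem stmt6 {n : ℕ} (v : E3) (w : ZMod n → E3) (hstar : IsStar v w)
    (u : E3) (hu : ‖u‖ = 1) :
    Set.InjOn (fun x : E3 => x - ⟪x - v, u⟫ • u) (starCarrier v w) ↔
    ((∀ i : ZMod n, ⟪starFN v w i, u⟫ ≠ 0) ∧
      ((∀ i : ZMod n, 0 < ⟪starFN v w i, u⟫) ∨ (∀ i : ZMod n, ⟪starFN v w i, u⟫ < 0))) := by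
  have h3 := hstar.1
  haveI : NeZero n := ⟨by omega⟩
  have hneg : (fun x : E3 => x - ⟪x - v, -u⟫ • (-u)) = fun x : E3 => x - ⟪x - v, u⟫ • u := by
    funext x
    rw [inner_neg_right, neg_smul_neg]
  constructor
  · intro hinj
    have hne := ne_of_inj v w hstar u hu hinj
    refine ⟨hne, ?_⟩
    rcases lt_or_gt_of_ne (hne 0) with h | h
    · right
      intro j
      have := zmod_all (fun i => 0 < ⟪starFN v w i, -u⟫)
        (fun i => pos_step v w hstar (-u) (by rw [norm_neg, hu]) (by rw [hneg]; exact hinj) i)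
        0 j (by rw [inner_neg_right]; linarith)
      simp only [inner_neg_right] at this
      linarith
    · left
      intro j
      exact zmod_all (fun i => 0 < ⟪starFN v w i, u⟫)
        (fun i => pos_step v w hstar u hu hinj i) 0 j h
  · rintro ⟨-, h | h⟩
    · exact inj_of_pos v w hstar u h
    · rw [← hneg]
      refine inj_of_pos v w hstar (-u) fun i => ?_
      rw [inner_neg_right]
      linarith [h i]
end
end

section
/- Let (v; w₀, …, w_{n−1}) be an embedded, immersed simplicial vertex star in ℝ³ whose Gauss image has no self-intersections and whose discrete Gaussian curvature K(v) is positive. Let x = Σᵢ λᵢ nᵢ with all λᵢ > 0 be any point of the open convex cone spanned by the face normals. Then there is a sign ε ∈ {−1, 1} such that ε · ⟨wⱼ − v, x⟩ > 0 for every j; consequently the plane {y ∈ ℝ³ : ⟨y − v, x⟩ = 0} intersects the carrier Star = ⋃ᵢ Tᵢ exactly in the single point v, and Star ∖ {v} lies in one open half-space bounded by this plane. (Proposition 2.16, simplicial case: every plane through v orthogonal to an interior point of the Gauss image is a supporting tangent plane, so nearby parallel planes cut the star in a discrete ellipse or not at all.) -/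
open RealInnerProductSpace

noncomputable section

/-- Parity of crossings of the segment `PQ` with the open positive `y`-ray. -/
noncomputable def crossPar (px py qx qy : ℝ) : ZMod 2 :=
  open Classical in
  if (px < 0 ∧ 0 ≤ qx ∧ 0 < py * qx - qy * px) ∨ (qx < 0 ∧ 0 ≤ px ∧ 0 < qy * px - py * qx)
  then 1 else 0

noncomputable def sgPar (px : ℝ) : ZMod 2 := open Classical in if px < 0 then 1 else 0

lemma crossPar_comm (px py qx qy : ℝ) : crossPar px py qx qy = crossPar qx qy px py := by
  unfold crossPar; simp only [or_comm]

lemma crossPar_zero (px py : ℝ) : crossPar px py 0 0 = 0 := by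
  unfold crossPar; rw [if_neg]; simp

lemma zero_crossPar (px py : ℝ) : crossPar 0 0 px py = 0 := by
  rw [crossPar_comm]; exact crossPar_zero _ _

lemma crossPar_lower (px py qx qy : ℝ) (hp : py ≤ 0) (hq : qy ≤ 0) :
    crossPar px py qx qy = 0 := by
  unfold crossPar; rw [if_neg]
  rintro (⟨h1, h2, h3⟩ | ⟨h1, h2, h3⟩) <;> nlinarith

/-- `0` is not in the convex hull of three planar points. -/
def NoZero3 (px py qx qy rx ry : ℝ) : Prop :=
  ∀ a b c : ℝ, 0 ≤ a → 0 ≤ b → 0 ≤ c → 0 < a + b + c →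
    a * px + b * qx + c * rx = 0 → a * py + b * qy + c * ry = 0 → False

lemma crossPar_upper (px py qx qy : ℝ) (hp : 0 ≤ py) (hq : 0 ≤ qy)
    (h : NoZero3 px py qx qy qx qy) :
    crossPar px py qx qy = sgPar px + sgPar qx := by
  unfold crossPar sgPar
  have key1 : px < 0 → 0 ≤ qx → 0 < py * qx - qy * px := by
    intro h1 h2
    have : 0 ≤ py * qx - qy * px := by nlinarith [mul_nonneg hp h2]
    rcases this.lt_or_eq with h3 | h3
    · exact h3
    · exact (h qx (-px) 0 h2 (by linarith) le_rfl (by linarith) (by ring) (by linarith)).elim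
  have key2 : qx < 0 → 0 ≤ px → 0 < qy * px - py * qx := by
    intro h1 h2
    have : 0 ≤ qy * px - py * qx := by nlinarith [mul_nonneg hq h2]
    rcases this.lt_or_eq with h3 | h3
    · exact h3
    · exact (h (-qx) px 0 (by linarith) (by linarith) le_rfl (by linarith) (by ring) (by linarith)).elim
  by_cases h1 : px < 0 <;> by_cases h2 : qx < 0
  · rw [if_neg (by rintro (⟨_, h, _⟩ | ⟨_, h, _⟩) <;> linarith), if_pos h1, if_pos h2]; decide
  · rw [if_pos (Or.inl ⟨h1, not_lt.1 h2, key1 h1 (not_lt.1 h2)⟩), if_pos h1, if_neg h2]; decide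
  · rw [if_pos (Or.inr ⟨h2, not_lt.1 h1, key2 h2 (not_lt.1 h1)⟩), if_neg h1, if_pos h2]; decide
  · rw [if_neg (by rintro (⟨h, _, _⟩ | ⟨h, _, _⟩) <;> linarith), if_neg h1, if_neg h2]; decide

lemma tri_aux1 (px py qx qy rx ry : ℝ) (h : NoZero3 px py qx qy rx ry)
    (hp : px < 0) (hq : 0 ≤ qx) (hr : 0 ≤ rx) (h1 : 0 < py * qx - qy * px) :
    0 < py * rx - ry * px := by
  by_contra h2
  push Not at h2
  refine h (-(py * rx - ry * px) * qx + (py * qx - qy * px) * rx) ((py * rx - ry * px) * px)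
    (-(py * qx - qy * px) * px) ?_ ?_ ?_ ?_ (by ring) (by ring)
  · nlinarith
  · nlinarith
  · nlinarith
  · have := mul_nonneg (neg_nonneg.2 h2) hq
    have := mul_nonneg h1.le hr
    have := mul_nonneg (neg_nonneg.2 h2) (neg_nonneg.2 hp.le)
    have := mul_pos h1 (neg_pos.2 hp)
    nlinarith

lemma tri_aux2 (px py qx qy rx ry : ℝ) (h : NoZero3 px py qx qy rx ry)
    (hp : 0 ≤ px) (hq : qx < 0) (hr : rx < 0) (h1 : 0 < qy * px - py * qx) :
    0 < ry * px - py * rx := by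
  by_contra h2
  push Not at h2
  have e1 := mul_nonneg (neg_nonneg.2 h2) hp
  have e2 := mul_nonneg h1.le hp
  have e3 := mul_nonneg (neg_nonneg.2 h2) (neg_nonneg.2 hq.le)
  have e4 := mul_pos h1 (neg_pos.2 hr)
  refine h ((ry * px - py * rx) * qx - (qy * px - py * qx) * rx) (-(ry * px - py * rx) * px)
    ((qy * px - py * qx) * px) ?_ ?_ ?_ ?_ (by ring) (by ring) <;> nlinarith

lemma NoZero3.swap {px py qx qy rx ry : ℝ} (h : NoZero3 px py qx qy rx ry) :
    NoZero3 px py rx ry qx qy := by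
  intro a b c ha hb hc hs h1 h2
  exact h a c b ha hc hb (by linarith) (by linarith) (by linarith)

lemma NoZero3.rot {px py qx qy rx ry : ℝ} (h : NoZero3 px py qx qy rx ry) :
    NoZero3 qx qy rx ry px py := by
  intro a b c ha hb hc hs h1 h2
  exact h c a b hc ha hb (by linarith) (by linarith) (by linarith)

/-- the odd-one-out case -/
lemma tri_odd (px py qx qy rx ry : ℝ) (h : NoZero3 px py qx qy rx ry)
    (hs : (px < 0 ∧ 0 ≤ qx ∧ 0 ≤ rx) ∨ (0 ≤ px ∧ qx < 0 ∧ rx < 0)) :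
    crossPar px py qx qy = crossPar px py rx ry ∧ crossPar qx qy rx ry = 0 := by
  unfold crossPar
  rcases hs with ⟨hp, hq, hr⟩ | ⟨hp, hq, hr⟩
  · constructor
    · congr 1
      apply propext
      constructor
      · rintro (⟨_, _, h3⟩ | ⟨h3, _, _⟩)
        · exact Or.inl ⟨hp, hr, tri_aux1 _ _ _ _ _ _ h hp hq hr h3⟩
        · linarith
      · rintro (⟨_, _, h3⟩ | ⟨h3, _, _⟩)
        · exact Or.inl ⟨hp, hq, tri_aux1 _ _ _ _ _ _ h.swap hp hr hq h3⟩
        · linarith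
    · rw [if_neg]; rintro (⟨h3, _, _⟩ | ⟨h3, _, _⟩) <;> linarith
  · constructor
    · congr 1
      apply propext
      constructor
      · rintro (⟨h3, _, _⟩ | ⟨_, _, h3⟩)
        · linarith
        · exact Or.inr ⟨hr, hp, tri_aux2 _ _ _ _ _ _ h hp hq hr h3⟩
      · rintro (⟨h3, _, _⟩ | ⟨_, _, h3⟩)
        · linarith
        · exact Or.inr ⟨hq, hp, tri_aux2 _ _ _ _ _ _ h.swap hp hr hq h3⟩
    · rw [if_neg]; rintro (⟨_, h3, _⟩ | ⟨_, h3, _⟩) <;> linarith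

lemma z2_add_self (a : ZMod 2) : a + a = 0 := by revert a; decide

/-- triangle rule -/
lemma crossPar_tri (px py qx qy rx ry : ℝ) (h : NoZero3 px py qx qy rx ry) :
    crossPar px py qx qy + crossPar qx qy rx ry = crossPar px py rx ry := by
  have same : ∀ ax ay bx bY : ℝ, (ax < 0 ∧ bx < 0) ∨ (0 ≤ ax ∧ 0 ≤ bx) →
      crossPar ax ay bx bY = 0 := by
    intro ax ay bx bY hh
    unfold crossPar; rw [if_neg]
    rcases hh with ⟨h1, h2⟩ | ⟨h1, h2⟩ <;> rintro (⟨h3, h4, _⟩ | ⟨h3, h4, _⟩) <;> linarith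
  have c1 := crossPar_comm qx qy px py
  have c2 := crossPar_comm rx ry px py
  have c3 := crossPar_comm rx ry qx qy
  have o1 := tri_odd _ _ _ _ _ _ h
  have o2 := tri_odd _ _ _ _ _ _ h.rot
  have o3 := tri_odd _ _ _ _ _ _ h.rot.rot
  rcases lt_or_ge px 0 with hp | hp <;> rcases lt_or_ge qx 0 with hq | hq <;>
    rcases lt_or_ge rx 0 with hr | hr
  · rw [same _ _ _ _ (Or.inl ⟨hp, hq⟩), same _ _ _ _ (Or.inl ⟨hq, hr⟩), same _ _ _ _ (Or.inl ⟨hp, hr⟩)]; rfl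
  · obtain ⟨h1, h2⟩ := o3 (Or.inr ⟨hr, hp, hq⟩)
    rw [h2, ← c2, h1, c3, zero_add]
  · obtain ⟨h1, h2⟩ := o2 (Or.inr ⟨hq, hr, hp⟩)
    rw [← c2, h2, h1, c1, z2_add_self]
  · obtain ⟨h1, h2⟩ := o1 (Or.inl ⟨hp, hq, hr⟩)
    rw [h1, h2, add_zero]
  · obtain ⟨h1, h2⟩ := o1 (Or.inr ⟨hp, hq, hr⟩)
    rw [h1, h2, add_zero]
  · obtain ⟨h1, h2⟩ := o2 (Or.inl ⟨hq, hr, hp⟩)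
    rw [← c2, h2, h1, c1, z2_add_self]
  · obtain ⟨h1, h2⟩ := o3 (Or.inl ⟨hr, hp, hq⟩)
    rw [h2, ← c2, h1, c3, zero_add]
  · rw [same _ _ _ _ (Or.inr ⟨hp, hq⟩), same _ _ _ _ (Or.inr ⟨hq, hr⟩), same _ _ _ _ (Or.inr ⟨hp, hr⟩)]; rfl

/-- corner computation -/
lemma corner_par (px py qx qy : ℝ) (hp : 0 ≤ py) (hq : 0 ≤ qy) (hd : px * qy - py * qx ≠ 0) :
    sgPar px + crossPar px py (-qx) (-qy) = open Classical in if px * qy - py * qx < 0 then 1 else 0 := by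
  unfold sgPar crossPar
  have hd' := lt_or_gt_of_ne hd
  rcases lt_or_ge px 0 with h1 | h1
  · rw [if_pos h1]
    rcases lt_or_ge 0 qx with h2 | h2
    · rw [if_neg, if_pos]
      · rfl
      · rcases hd' with h | h
        · exact h
        · nlinarith [mul_nonneg hp h2.le, mul_nonneg hq (neg_nonneg.2 h1.le)]
      · rintro (⟨_, h3, _⟩ | ⟨_, h3, _⟩) <;> linarith
    · rcases hd' with h | h
      · rw [if_neg, if_pos h]
        · rfl
        · rintro (⟨_, h3, _⟩ | ⟨_, h3, _⟩) <;> linarith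
      · rw [if_pos, if_neg h.le.not_gt]
        · rfl
        · left; exact ⟨h1, by linarith, by linarith⟩
  · rw [if_neg h1.not_gt, zero_add]
    rcases lt_or_ge 0 qx with h2 | h2
    · rcases hd' with h | h
      · rw [if_pos, if_pos h]
        right; exact ⟨by linarith, h1, by linarith⟩
      · rw [if_neg, if_neg h.le.not_gt]
        rintro (⟨h3, _, _⟩ | ⟨_, _, h3⟩) <;> linarith
    · rw [if_neg, if_neg]
      · nlinarith [mul_nonneg hq h1, mul_nonneg hp (neg_nonneg.2 h2)]
      · rintro (⟨h3, _, _⟩ | ⟨h3, _, _⟩) <;> linarith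

lemma grid_tele (h vv : ℕ → ℕ → ZMod 2) (d e : ℕ) :
    ∑ s ∈ Finset.range d, ∑ t ∈ Finset.range e,
      (h s t + h s (t + 1) + vv s t + vv (s + 1) t) =
    ∑ s ∈ Finset.range d, (h s 0 + h s e) + ∑ t ∈ Finset.range e, (vv 0 t + vv d t) := by
  have tele : ∀ (f : ℕ → ZMod 2) (k : ℕ), ∑ i ∈ Finset.range k, (f i + f (i + 1)) = f 0 + f k := by
    intro f k
    induction k with
    | zero => simp [z2_add_self]
    | succ k ih =>
      rw [Finset.sum_range_succ, ih]
      have := z2_add_self (f k)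
      linear_combination this
  have : ∀ s t, (h s t + h s (t + 1) + vv s t + vv (s + 1) t) =
    (h s t + h s (t + 1)) + (vv s t + vv (s + 1) t) := by intros; ring
  simp_rw [this, Finset.sum_add_distrib (f := fun t => h _ t + h _ (t + 1))]
  rw [Finset.sum_add_distrib]
  congr 1
  · exact Finset.sum_congr rfl fun s _ => tele (h s) e
  · rw [Finset.sum_comm]
    exact Finset.sum_congr rfl fun t _ => tele (fun s => vv s t) d

/-- The segments `AB` and `CD` in the plane are disjoint (homogeneous form). -/
def SegDisj (ax ay bx bY cx cy dx dy : ℝ) : Prop :=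
  ∀ α β γ δ : ℝ, 0 ≤ α → 0 ≤ β → 0 ≤ γ → 0 ≤ δ → 0 < α + β → α + β = γ + δ →
    α * ax + β * bx = γ * cx + δ * dx → α * ay + β * bY = γ * cy + δ * dy → False

lemma cell_par (ax ay bx bY cx cy dx dy : ℝ) (h : SegDisj ax ay bx bY cx cy dx dy) :
    crossPar (ax - cx) (ay - cy) (bx - cx) (bY - cy) +
      crossPar (ax - dx) (ay - dy) (bx - dx) (bY - dy) +
      crossPar (ax - cx) (ay - cy) (ax - dx) (ay - dy) +
      crossPar (bx - cx) (bY - cy) (bx - dx) (bY - dy) = 0 := by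
  have t1 := crossPar_tri (ax - cx) (ay - cy) (bx - cx) (bY - cy) (bx - dx) (bY - dy) (by
    intro a b c ha hb hc hs h1 h2
    exact h a (b + c) (a + b) c ha (by positivity) (by positivity) hc (by linarith) (by ring)
      (by linarith) (by linarith))
  have t2 := crossPar_tri (ax - cx) (ay - cy) (ax - dx) (ay - dy) (bx - dx) (bY - dy) (by
    intro a b c ha hb hc hs h1 h2
    exact h (a + b) c a (b + c) (by positivity) hc ha (by positivity) (by linarith) (by ring)
      (by linarith) (by linarith))
  have := z2_add_self (crossPar (ax - cx) (ay - cy) (bx - dx) (bY - dy))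
  linear_combination t1 + t2 + this

lemma noZero_indep (px py qx qy : ℝ) (hd : px * qy - py * qx ≠ 0) :
    NoZero3 px py (px - qx) (py - qy) (-qx) (-qy) := by
  intro a b c ha hb hc hs h1 h2
  have e1 : (a + b) * (px * qy - py * qx) = 0 := by linear_combination qy * h1 - qx * h2
  have e2 : (b + c) * (px * qy - py * qx) = 0 := by linear_combination py * h1 - px * h2
  have := (mul_eq_zero.1 e1).resolve_right hd
  have := (mul_eq_zero.1 e2).resolve_right hd
  linarith

lemma side_sum (px py : ℕ → ℝ) (k : ℕ) (hup : ∀ s ≤ k, 0 ≤ py s)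
    (h : ∀ s < k, NoZero3 (px s) (py s) (px (s + 1)) (py (s + 1)) (px (s + 1)) (py (s + 1))) :
    ∑ s ∈ Finset.range k, crossPar (px s) (py s) (px (s + 1)) (py (s + 1)) =
      sgPar (px 0) + sgPar (px k) := by
  induction k with
  | zero => simp [z2_add_self]
  | succ k ih =>
    rw [Finset.sum_range_succ, ih (fun s hs => hup s (by omega)) (fun s hs => h s (by omega)),
      crossPar_upper _ _ _ _ (hup k (by omega)) (hup (k + 1) le_rfl) (h k (by omega))]
    linear_combination z2_add_self (sgPar (px k))

/-- Planar orientation lemma, natural-number indexed version.  The closed polygon has vertices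
`0, …, n = d + e`, the vertices `0` and `d` lie on the supporting line `y = 0`. -/
lemma planar_core (X Y : ℕ → ℝ) (d e : ℕ) (hd : 1 ≤ d) (he : 1 ≤ e) (hn : 3 ≤ d + e)
    (hX : X (d + e) = X 0) (hY : Y (d + e) = Y 0)
    (hdis : ∀ p r, p < r → r < d + e → r ≠ p + 1 → ¬ (p = 0 ∧ r + 1 = d + e) →
      SegDisj (X p) (Y p) (X (p + 1)) (Y (p + 1)) (X r) (Y r) (X (r + 1)) (Y (r + 1)))
    (hA : ∀ s, 1 ≤ s → s + 1 < d + e →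
      SegDisj (X s) (Y s) (X (s + 1)) (Y (s + 1)) (X 0) (Y 0) (X 0) (Y 0))
    (hB : ∀ s, s + 1 < d →
      SegDisj (X s) (Y s) (X (s + 1)) (Y (s + 1)) (X d) (Y d) (X d) (Y d))
    (hpos : ∀ s, 0 ≤ Y s) (hY0 : Y 0 = 0) (hYd : Y d = 0) (hlt : X 0 < X d)
    (tA : (X 1 - X 0) * (Y (d + e - 1) - Y 0) - (Y 1 - Y 0) * (X (d + e - 1) - X 0) ≠ 0)
    (tB : (X (d - 1) - X d) * (Y (d + 1) - Y d) - (Y (d - 1) - Y d) * (X (d + 1) - X d) ≠ 0) :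
    ((X 1 - X 0) * (Y (d + e - 1) - Y 0) - (Y 1 - Y 0) * (X (d + e - 1) - X 0)) *
    ((X (d - 1) - X d) * (Y (d + 1) - Y d) - (Y (d - 1) - Y d) * (X (d + 1) - X d)) < 0 := by
  obtain ⟨d, rfl⟩ : ∃ d', d = d' + 1 := ⟨d - 1, by omega⟩
  obtain ⟨e, rfl⟩ : ∃ e', e = e' + 1 := ⟨e - 1, by omega⟩
  have i1 : d + 1 + (e + 1) - 1 = d + 1 + e := by omega
  have i2 : d + 1 - 1 = d := by omega
  rw [i1] at tA ⊢
  rw [i2] at tB ⊢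
  set gx : ℕ → ℕ → ℝ := fun s t => X s - X (d + 1 + t) with hgx
  set gy : ℕ → ℕ → ℝ := fun s t => Y s - Y (d + 1 + t) with hgy
  have G := grid_tele (fun s t => crossPar (gx s t) (gy s t) (gx (s + 1) t) (gy (s + 1) t))
    (fun s t => crossPar (gx s t) (gy s t) (gx s (t + 1)) (gy s (t + 1))) (d + 1) (e + 1)
  beta_reduce at G
  -- lower sides
  have low : ∑ t ∈ Finset.range (e + 1), (crossPar (gx 0 t) (gy 0 t) (gx 0 (t + 1)) (gy 0 (t + 1))
      + crossPar (gx (d + 1) t) (gy (d + 1) t) (gx (d + 1) (t + 1)) (gy (d + 1) (t + 1))) = 0 := by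
    apply Finset.sum_eq_zero
    intro t _
    have h1 := hpos (d + 1 + t)
    have h2 := hpos (d + 1 + (t + 1))
    rw [crossPar_lower, crossPar_lower, add_zero] <;> simp only [hgy] <;> linarith
  -- bottom side `t = 0`
  have bot : ∑ s ∈ Finset.range (d + 1), crossPar (gx s 0) (gy s 0) (gx (s + 1) 0) (gy (s + 1) 0)
      = 1 + sgPar (X d - X (d + 1)) := by
    rw [Finset.sum_range_succ]
    have hz1 : gx (d + 1) 0 = 0 := by simp [hgx]
    have hz2 : gy (d + 1) 0 = 0 := by simp [hgy]
    rw [hz1, hz2, crossPar_zero, add_zero]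
    rw [side_sum (fun s => gx s 0) (fun s => gy s 0)]
    · congr 1
      unfold sgPar; rw [if_pos]; simp only [hgx, add_zero]; linarith
    · intro s _
      have := hpos s
      simp only [hgy, add_zero]; linarith
    · intro s hs a b c ha hb hc hsum h1 h2
      simp only [hgx, hgy, add_zero] at h1 h2
      exact hB s (by omega) a (b + c) (a + b + c) 0 ha (by positivity) (by positivity) le_rfl
        (by linarith) (by ring) (by linarith) (by linarith)
  have top : ∑ s ∈ Finset.range (d + 1),
      crossPar (gx s (e + 1)) (gy s (e + 1)) (gx (s + 1) (e + 1)) (gy (s + 1) (e + 1))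
      = sgPar (X 1 - X 0) := by
    rw [Finset.sum_range_succ']
    have hz1 : gx 0 (e + 1) = 0 := by simp only [hgx]; rw [hX]; ring
    have hz2 : gy 0 (e + 1) = 0 := by simp only [hgy]; rw [hY]; ring
    rw [hz1, hz2, zero_crossPar, add_zero]
    rw [side_sum (fun s => gx (s + 1) (e + 1)) (fun s => gy (s + 1) (e + 1))]
    · have : sgPar (gx (d + 1) (e + 1)) = 0 := by
        unfold sgPar; rw [if_neg]; simp only [hgx]; rw [hX]; linarith
      rw [this, add_zero]
      simp only [hgx, zero_add]; rw [hX]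
    · intro s _
      have := hpos (s + 1)
      simp only [hgy]; rw [hY]; linarith
    · intro s hs a b c ha hb hc hsum h1 h2
      simp only [hgx, hgy] at h1 h2
      rw [hX] at h1
      rw [hY] at h2
      exact hA (s + 1) (by omega) (by omega) a (b + c) (a + b + c) 0 ha (by positivity)
        (by positivity) le_rfl (by linarith) (by ring) (by linarith) (by linarith)
  rw [low, add_zero, Finset.sum_add_distrib, bot, top] at G
  -- cells
  set F : ℕ → ℕ → ZMod 2 := fun s t =>
    crossPar (gx s t) (gy s t) (gx (s + 1) t) (gy (s + 1) t) +
    crossPar (gx s (t + 1)) (gy s (t + 1)) (gx (s + 1) (t + 1)) (gy (s + 1) (t + 1)) +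
    crossPar (gx s t) (gy s t) (gx s (t + 1)) (gy s (t + 1)) +
    crossPar (gx (s + 1) t) (gy (s + 1) t) (gx (s + 1) (t + 1)) (gy (s + 1) (t + 1)) with hF
  have cell0 : ∀ s t, s ≤ d → t ≤ e → ¬ (s = d ∧ t = 0) → ¬ (s = 0 ∧ t = e) → F s t = 0 := by
    intro s t hs ht n1 n2
    exact cell_par _ _ _ _ _ _ _ _ (hdis s (d + 1 + t) (by omega) (by omega) (by omega) (by omega))
  have cellB : F d 0 = crossPar (X d - X (d + 1)) (Y d - Y (d + 1))
      (-(X (d + 1 + 1) - X (d + 1))) (-(Y (d + 1 + 1) - Y (d + 1))) := by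
    have T := crossPar_tri _ _ _ _ _ _ (noZero_indep _ _ _ _ tB)
    rw [← T]
    simp only [hF, hgx, hgy, add_zero, zero_add, sub_self, crossPar_zero, zero_crossPar]
    rw [add_comm (crossPar _ _ _ _) (crossPar (X d - X (d + 1)) _ _ _)]
    congr 2 <;> ring
  have cellA : F 0 e = crossPar (X 1 - X 0) (Y 1 - Y 0)
      (-(X (d + 1 + e) - X 0)) (-(Y (d + 1 + e) - Y 0)) := by
    have T := crossPar_tri _ _ _ _ _ _ (noZero_indep _ _ _ _ tA)
    rw [← T]
    have hX' : X (d + 1 + (e + 1)) = X 0 := hX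
    have hY' : Y (d + 1 + (e + 1)) = Y 0 := hY
    simp only [hF, hgx, hgy, zero_add, hX', hY', sub_self, crossPar_zero, zero_crossPar, add_zero]
    have e1 : ∀ x y z : ℝ, x - y = (x - z) - (y - z) := by intros; ring
    have e2 : ∀ x y : ℝ, x - y = -(y - x) := by intros; ring
    rw [crossPar_comm (X 0 - X (d + 1 + e)), add_comm, crossPar_comm (X 1 - X (d + 1 + e)) _ (X 1 - X 0)]
    rw [e1 (X 1) (X (d + 1 + e)) (X 0), e1 (Y 1) (Y (d + 1 + e)) (Y 0),
      e2 (X 0) (X (d + 1 + e)), e2 (Y 0) (Y (d + 1 + e))]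
  have hsum : ∑ s ∈ Finset.range (d + 1), ∑ t ∈ Finset.range (e + 1), F s t = F d 0 + F 0 e := by
    rw [← Finset.sum_product']
    rw [Finset.sum_eq_add_of_mem (d, 0) (0, e)]
    · simp
    · simp
    · simp only [ne_eq, Prod.mk.injEq]; omega
    · rintro ⟨s, t⟩ hst ⟨h1, h2⟩
      simp only [Finset.mem_product, Finset.mem_range, ne_eq, Prod.mk.injEq] at hst h1 h2
      exact cell0 s t (by omega) (by omega) h1 h2
  rw [hsum, cellA, cellB] at G
  have cA := corner_par _ _ _ _ (by linarith [hpos 1] : 0 ≤ Y 1 - Y 0)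
    (by linarith [hpos (d + 1 + e)] : 0 ≤ Y (d + 1 + e) - Y 0) tA
  have cB := corner_par _ _ _ _ (by linarith [hpos d] : 0 ≤ Y d - Y (d + 1))
    (by linarith [hpos (d + 1 + 1)] : 0 ≤ Y (d + 1 + 1) - Y (d + 1)) tB
  have tot := congrArg₂ (· + ·) cA cB
  beta_reduce at tot
  have one : ∀ a b c d' e' f : ZMod 2, a + b = 1 + c + d' → (d' + b) + (c + a) = e' + f → e' + f = 1 := by
    decide
  have fin := one _ _ _ _ _ _ G tot
  rcases lt_or_gt_of_ne tA with hA' | hA' <;> rcases lt_or_gt_of_ne tB with hB' | hB'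
  · rw [if_pos hA', if_pos hB'] at fin; exact absurd fin (by decide)
  · exact mul_neg_of_neg_of_pos hA' hB'
  · exact mul_neg_of_pos_of_neg hA' hB'
  · rw [if_neg hA'.le.not_gt, if_neg hB'.le.not_gt] at fin; exact absurd fin (by decide)

lemma zmod_cast_lt {n p r : ℕ} (hp : p < n) (hr : r < n) (h : (p : ZMod n) = r) : p = r := by
  rw [ZMod.natCast_eq_natCast_iff', Nat.mod_eq_of_lt hp, Nat.mod_eq_of_lt hr] at h
  exact h

lemma zmod_cast_succ {n p r : ℕ} (hp : p < n) (hr : r < n) (h : (p : ZMod n) = r + 1) :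
    p = r + 1 ∨ (p = 0 ∧ r + 1 = n) := by
  have h' : (p : ZMod n) = ((r + 1 : ℕ) : ZMod n) := by push_cast; exact h
  rcases Nat.lt_or_ge (r + 1) n with h1 | h1
  · exact Or.inl (zmod_cast_lt hp h1 h')
  · have h2 : r + 1 = n := by omega
    rw [h2] at h'
    right
    refine ⟨zmod_cast_lt hp (by omega) ?_, h2⟩
    rw [h']; simp

/-- orientation of the planar polygon at the vertex `i` -/
def turnAt {n : ℕ} (X Y : ZMod n → ℝ) (i : ZMod n) : ℝ :=
  (X (i + 1) - X i) * (Y (i - 1) - Y i) - (Y (i + 1) - Y i) * (X (i - 1) - X i)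

lemma planar_zmod {n : ℕ} [NeZero n] (hn : 3 ≤ n) (X Y : ZMod n → ℝ)
    (hdis : ∀ i j : ZMod n, i ≠ j → j ≠ i + 1 → i ≠ j + 1 →
      SegDisj (X i) (Y i) (X (i + 1)) (Y (i + 1)) (X j) (Y j) (X (j + 1)) (Y (j + 1)))
    (hT : ∀ i, turnAt X Y i ≠ 0) (hpos : ∀ i, 0 ≤ Y i) (j k : ZMod n) (hj : Y j = 0)
    (hk : Y k = 0) (hlt : X j < X k) : 0 < turnAt X Y j * turnAt X Y k := by
  have vtx : ∀ i s : ZMod n, i ≠ s → i ≠ s + 1 →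
      SegDisj (X s) (Y s) (X (s + 1)) (Y (s + 1)) (X i) (Y i) (X i) (Y i) := by
    intro i s h1 h2 α β γ δ hα hβ hγ hδ hs hs' e1 e2
    by_cases h3 : s = i + 1
    · apply hT s
      subst h3
      have : (α + β) * turnAt X Y (i + 1) = 0 := by
        unfold turnAt
        rw [add_sub_cancel_right]
        have e1' : (α + β) * (X i - X (i + 1)) = β * (X (i + 1 + 1) - X (i + 1)) := by
          linear_combination -e1 + X i * hs'
        have e2' : (α + β) * (Y i - Y (i + 1)) = β * (Y (i + 1 + 1) - Y (i + 1)) := by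
          linear_combination -e2 + Y i * hs'
        linear_combination (X (i + 1 + 1) - X (i + 1)) * e2' - (Y (i + 1 + 1) - Y (i + 1)) * e1'
      exact (mul_eq_zero.1 this).resolve_left hs.ne'
    · exact hdis i s h1 h3 h2 (γ + δ) 0 α β (by positivity) le_rfl hα hβ (by linarith)
        (by linarith) (by linarith) (by linarith)
  obtain ⟨d, hd, rfl⟩ : ∃ d < n, k = j + (d : ℕ) :=
    ⟨(k - j).val, ZMod.val_lt _, by rw [ZMod.natCast_zmod_val]; ring⟩
  have hd0 : d ≠ 0 := by rintro rfl; simp at hlt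
  obtain ⟨e, rfl⟩ := Nat.exists_eq_add_of_le hd.le
  have inj : ∀ p r : ℕ, p < d + e → r < d + e → j + (p : ZMod (d + e)) = j + r → p = r := by
    intro p r hp hr h
    exact zmod_cast_lt hp hr (add_left_cancel h)
  have sc : ∀ p r : ℕ, p < d + e → r < d + e → j + (p : ZMod (d + e)) = j + r + 1 →
      p = r + 1 ∨ (p = 0 ∧ r + 1 = d + e) := by
    intro p r hp hr h
    rw [add_assoc] at h
    exact zmod_cast_succ hp hr (add_left_cancel h)
  have cs : ∀ p : ℕ, j + ((p + 1 : ℕ) : ZMod (d + e)) = j + p + 1 := by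
    intro p; push_cast; ring
  have cn : j + ((d + e : ℕ) : ZMod (d + e)) = j := by simp
  have c0 : j + ((0 : ℕ) : ZMod (d + e)) = j := by simp
  have c1 : j + ((1 : ℕ) : ZMod (d + e)) = j + 1 := by simp
  have cl : j + ((d + e - 1 : ℕ) : ZMod (d + e)) = j - 1 := by
    have := cs (d + e - 1)
    rw [Nat.sub_add_cancel (by omega), cn] at this
    linear_combination -this
  have cd : j + ((d - 1 : ℕ) : ZMod (d + e)) = j + d - 1 := by
    have := cs (d - 1)
    rw [Nat.sub_add_cancel (by omega)] at this
    linear_combination -this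
  have tA := hT j
  have tB := hT (j + d)
  have key := planar_core (fun s => X (j + s)) (fun s => Y (j + s)) d e (by omega) (by omega) hn
    (by simp only [cn, c0]) (by simp only [cn, c0])
    (by
      intro p r hpr hr h1 h2
      simp only [cs]
      apply hdis
      · intro h; have := inj _ _ (by omega) hr h; omega
      · intro h; rcases sc _ _ hr (by omega) h with h | h <;> omega
      · intro h; rcases sc _ _ (by omega) hr h with h | h <;> omega)
    (by
      intro s h1 h2
      simp only [cs]
      apply vtx
      · intro h; have := inj _ _ (by omega) (by omega) h; omega
      · intro h; rcases sc _ _ (by omega) (by omega) h with h | h <;> omega)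
    (by
      intro s h1
      simp only [cs]
      apply vtx
      · intro h; have := inj _ _ (by omega) (by omega) h; omega
      · intro h; rcases sc _ _ (by omega) (by omega) h with h | h <;> omega)
    (fun s => hpos _) (by simpa only [c0] using hj) hk (by simpa only [c0] using hlt)
    (by simp only [c0, c1, cl]; exact tA)
    (by
      simp only [cd, cs]; intro h; apply tB; unfold turnAt; linear_combination -h)
  simp only [c0, c1, cl, cd, cs] at key
  unfold turnAt
  linarith

lemma angle_seg_add (a b : E3) (ha : a ≠ 0) (hb : b ≠ 0) (t : ℝ) (h0 : 0 ≤ t) (h1 : t ≤ 1) 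
    (hq : (1 - t) • a + t • b ≠ 0) :
    InnerProductGeometry.angle a ((1 - t) • a + t • b) +
      InnerProductGeometry.angle ((1 - t) • a + t • b) b = InnerProductGeometry.angle a b := by
  rcases h0.eq_or_lt with rfl | h0
  · simp [InnerProductGeometry.angle_self ha]
  rcases h1.eq_or_lt with rfl | h1
  · simp [InnerProductGeometry.angle_self hb]
  have h1' : 0 < 1 - t := by linarith
  have := InnerProductGeometry.angle_eq_angle_add_add_angle_add ((1 - t) • a) (y := t • b)
    (smul_ne_zero h0.ne' hb)
  rw [InnerProductGeometry.angle_smul_left_of_pos _ _ h1',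
    InnerProductGeometry.angle_smul_left_of_pos _ _ h1',
    InnerProductGeometry.angle_smul_right_of_pos _ _ h0,
    InnerProductGeometry.angle_smul_left_of_pos _ _ h0,
    InnerProductGeometry.angle_comm b] at this
  exact this.symm

lemma inner_pos_of_angle_sum (p q y : E3) (hp : p ≠ 0) (hq : q ≠ 0) (hy : y ≠ 0)
    (h : InnerProductGeometry.angle p y + InnerProductGeometry.angle y q < Real.pi) :
    0 < ⟪‖p‖⁻¹ • p + ‖q‖⁻¹ • q, y⟫ := by
  have c1 := InnerProductGeometry.cos_angle_mul_norm_mul_norm p y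
  have c2 := InnerProductGeometry.cos_angle_mul_norm_mul_norm y q
  have hcos : Real.cos (Real.pi - InnerProductGeometry.angle y q) <
      Real.cos (InnerProductGeometry.angle p y) := by
    apply Real.cos_lt_cos_of_nonneg_of_le_pi (InnerProductGeometry.angle_nonneg _ _)
    · linarith [InnerProductGeometry.angle_nonneg y q]
    · linarith
  rw [Real.cos_pi_sub] at hcos
  have np := norm_pos_iff.2 hp
  have nq := norm_pos_iff.2 hq
  have ny := norm_pos_iff.2 hy
  rw [inner_add_left, real_inner_smul_left, real_inner_smul_left, real_inner_comm y q, ← c1, ← c2]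
  have e : ‖p‖⁻¹ * (Real.cos (InnerProductGeometry.angle p y) * (‖p‖ * ‖y‖)) +
      ‖q‖⁻¹ * (Real.cos (InnerProductGeometry.angle y q) * (‖y‖ * ‖q‖)) =
      ‖y‖ * (Real.cos (InnerProductGeometry.angle p y) + Real.cos (InnerProductGeometry.angle y q)) := by
    field_simp
  rw [e]
  exact mul_pos ny (by linarith)

/-- A closed spherical polygon of length less than `2π` lies in an open hemisphere. -/
lemma hemisphere (b : ℕ → E3) (n : ℕ) (hper : b n = b 0)
    (hli : ∀ i, LinearIndependent ℝ ![b i, b (i + 1)])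
    (hK : ∑ i ∈ Finset.range n, InnerProductGeometry.angle (b i) (b (i + 1)) < 2 * Real.pi) :
    ∃ u : E3, ∀ i < n, 0 < ⟪u, b i⟫ := by
  have hne : ∀ i, b i ≠ 0 := fun i => (hli i).ne_zero 0
  set S : ℕ → ℝ := fun k => ∑ i ∈ Finset.range k, InnerProductGeometry.angle (b i) (b (i + 1)) with hS
  have S0 : S 0 = 0 := by simp [hS]
  have Ssucc : ∀ k, S (k + 1) = S k + InnerProductGeometry.angle (b k) (b (k + 1)) := by
    intro k; simp [hS, Finset.sum_range_succ]
  have tri : ∀ i m, InnerProductGeometry.angle (b i) (b (i + m)) ≤ S (i + m) - S i := by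
    intro i m
    induction m with
    | zero => simp [InnerProductGeometry.angle_self (hne i)]
    | succ m ih =>
      have := InnerProductGeometry.angle_le_angle_add_angle (b i) (b (i + m)) (b (i + m + 1))
      have h2 := Ssucc (i + m)
      rw [← add_assoc]; linarith
  have tri' : ∀ i j, i ≤ j → InnerProductGeometry.angle (b i) (b j) ≤ S j - S i := by
    intro i j hij
    obtain ⟨m, rfl⟩ := Nat.exists_eq_add_of_le hij
    exact tri i m
  have Snn : 0 ≤ S n := Finset.sum_nonneg fun i _ => InnerProductGeometry.angle_nonneg _ _
  -- find the half way edge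
  rcases Nat.eq_zero_or_pos n with rfl | hn
  · exact ⟨0, by simp⟩
  obtain ⟨k, hkn, hk1, hk2⟩ : ∃ k < n, S k ≤ S n / 2 ∧ S n / 2 ≤ S (k + 1) := by
    by_contra hcon
    push Not at hcon
    have : ∀ k ≤ n, S k ≤ S n / 2 := by
      intro k
      induction k with
      | zero => intro _; rw [S0]; linarith
      | succ k ih => intro hk; exact (hcon k (by omega) (ih (by omega))).le
    have h1 := this n le_rfl
    have h2 := hcon (n - 1) (by omega) (this (n - 1) (by omega))
    rw [Nat.sub_add_cancel hn] at h2
    linarith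
  have hseg : ∀ t : ℝ, (1 - t) • b k + t • b (k + 1) ≠ 0 := by
    intro t h
    have := LinearIndependent.pair_iff.1 (hli k) _ _ h
    linarith [this.1, this.2]
  have hcont : Continuous fun t : ℝ =>
      InnerProductGeometry.angle (b k) ((1 - t) • b k + t • b (k + 1)) := by
    rw [continuous_iff_continuousAt]
    intro t
    have h1 := InnerProductGeometry.continuousAt_angle (x := (b k, (1 - t) • b k + t • b (k + 1)))
      (hne k) (hseg t)
    exact ContinuousAt.comp (f := fun t : ℝ => (b k, (1 - t) • b k + t • b (k + 1))) h1
      (by fun_prop)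
  obtain ⟨t, ht, hteq⟩ : ∃ t ∈ Set.Icc (0 : ℝ) 1,
      InnerProductGeometry.angle (b k) ((1 - t) • b k + t • b (k + 1)) = S n / 2 - S k := by
    have := intermediate_value_Icc (zero_le_one (α := ℝ)) hcont.continuousOn
    apply this
    have := Ssucc k
    simp [InnerProductGeometry.angle_self (hne k)]
    constructor <;> linarith
  have hadd := angle_seg_add _ _ (hne k) (hne (k + 1)) t ht.1 ht.2 (hseg t)
  set Q := (1 - t) • b k + t • b (k + 1) with hQ
  refine ⟨‖b 0‖⁻¹ • b 0 + ‖Q‖⁻¹ • Q, fun i hi => ?_⟩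
  apply inner_pos_of_angle_sum _ _ _ (hne 0) (hseg t) (hne i)
  have hk3 := Ssucc k
  rcases Nat.lt_or_ge k i with h | h
  · have h1 := tri' i n hi.le
    have h2 := tri' (k + 1) i h
    have h3 := InnerProductGeometry.angle_le_angle_add_angle Q (b (k + 1)) (b i)
    rw [hper, InnerProductGeometry.angle_comm] at h1
    rw [InnerProductGeometry.angle_comm (b i)]
    linarith
  · have h1 := tri' 0 i (Nat.zero_le _)
    have h2 := tri' i k h
    have h3 := InnerProductGeometry.angle_le_angle_add_angle (b i) (b k) Q
    linarith

lemma inner3 (a b : E3) : ⟪a, b⟫ = a 0 * b 0 + a 1 * b 1 + a 2 * b 2 := by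
  simp [PiLp.inner_apply, Fin.sum_univ_three]; ring

def det3 (p q r : E3) : ℝ :=
  (p 1 * q 2 - p 2 * q 1) * r 0 + (p 2 * q 0 - p 0 * q 2) * r 1 + (p 0 * q 1 - p 1 * q 0) * r 2

lemma cross3_0 (a b : E3) : cross3 a b 0 = a 1 * b 2 - a 2 * b 1 := by simp [cross3]
lemma cross3_1 (a b : E3) : cross3 a b 1 = a 2 * b 0 - a 0 * b 2 := by simp [cross3]
lemma cross3_2 (a b : E3) : cross3 a b 2 = a 0 * b 1 - a 1 * b 0 := by simp [cross3]

lemma inner_cross3 (p q r : E3) : ⟪cross3 p q, r⟫ = det3 p q r := by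
  rw [inner3, cross3_0, cross3_1, cross3_2, det3]

lemma ext3 {a b : E3} (h0 : a 0 = b 0) (h1 : a 1 = b 1) (h2 : a 2 = b 2) : a = b := by
  ext i; fin_cases i <;> assumption

lemma eq_zero_of_inner3 {p q r z : E3} (hd : det3 p q r ≠ 0) (h1 : ⟪z, p⟫ = 0) (h2 : ⟪z, q⟫ = 0)
    (h3 : ⟪z, r⟫ = 0) : z = 0 := by
  rw [inner3] at h1 h2 h3
  apply ext3
  · apply (mul_eq_zero.1 (?_ : det3 p q r * z 0 = 0)).resolve_left hd
    unfold det3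
    linear_combination (q 1 * r 2 - q 2 * r 1) * h1 + (r 1 * p 2 - r 2 * p 1) * h2 +
      (p 1 * q 2 - p 2 * q 1) * h3
  · apply (mul_eq_zero.1 (?_ : det3 p q r * z 1 = 0)).resolve_left hd
    unfold det3
    linear_combination (q 2 * r 0 - q 0 * r 2) * h1 + (r 2 * p 0 - r 0 * p 2) * h2 +
      (p 2 * q 0 - p 0 * q 2) * h3
  · apply (mul_eq_zero.1 (?_ : det3 p q r * z 2 = 0)).resolve_left hd
    unfold det3
    linear_combination (q 0 * r 1 - q 1 * r 0) * h1 + (r 0 * p 1 - r 1 * p 0) * h2 +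
      (p 0 * q 1 - p 1 * q 0) * h3

lemma det3_ne_of_orth {e m u p : E3} (he : e ≠ 0) (hm : m ≠ 0) (hem : ⟪e, m⟫ = 0)
    (heu : ⟪e, u⟫ = 0) (hmp : ⟪m, p⟫ = 0) (hup : 0 < ⟪u, p⟫) : det3 e m u ≠ 0 := by
  intro hd
  have hc : cross3 m u ≠ 0 := by
    intro hc
    apply hm
    have c0 := cross3_0 m u
    have c1 := cross3_1 m u
    have c2 := cross3_2 m u
    rw [hc] at c0 c1 c2
    simp only [PiLp.zero_apply] at c0 c1 c2
    rw [inner3] at hmp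
    rw [inner3] at hup
    apply ext3
    · apply (mul_eq_zero.1 (?_ : (u 0 * p 0 + u 1 * p 1 + u 2 * p 2) * m 0 = 0)).resolve_left hup.ne'
      linear_combination u 0 * hmp + p 2 * c1 - p 1 * c2
    · apply (mul_eq_zero.1 (?_ : (u 0 * p 0 + u 1 * p 1 + u 2 * p 2) * m 1 = 0)).resolve_left hup.ne'
      linear_combination u 1 * hmp + p 0 * c2 - p 2 * c0
    · apply (mul_eq_zero.1 (?_ : (u 0 * p 0 + u 1 * p 1 + u 2 * p 2) * m 2 = 0)).resolve_left hup.ne'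
      linear_combination u 2 * hmp + p 1 * c0 - p 0 * c1
  have h1 := real_inner_self_pos.2 he
  have h2 := real_inner_self_pos.2 hc
  have : ⟪e, e⟫ * ⟪cross3 m u, cross3 m u⟫ = 0 := by
    rw [inner3 e m] at hem
    rw [inner3 e u] at heu
    rw [inner3, inner3, cross3_0, cross3_1, cross3_2]
    unfold det3 at hd
    linear_combination ((e 1 * m 2 - e 2 * m 1) * u 0 + (e 2 * m 0 - e 0 * m 2) * u 1 +
      (e 0 * m 1 - e 1 * m 0) * u 2) * hd +
      ((e 0 * u 0 + e 1 * u 1 + e 2 * u 2) * (m 0 ^ 2 + m 1 ^ 2 + m 2 ^ 2) -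
        2 * (e 0 * m 0 + e 1 * m 1 + e 2 * m 2) * (m 0 * u 0 + m 1 * u 1 + m 2 * u 2)) * heu +
      (e 0 * m 0 + e 1 * m 1 + e 2 * m 2) * (u 0 ^ 2 + u 1 ^ 2 + u 2 ^ 2) * hem
  exact (mul_pos h1 h2).ne' this

lemma gram_turn (e m u p q r : E3) :
    det3 p q r * det3 e m u =
      (⟪p, e⟫ * (⟪q, m⟫ * ⟪r, u⟫ - ⟪q, u⟫ * ⟪r, m⟫) - ⟪p, m⟫ * (⟪q, e⟫ * ⟪r, u⟫ - ⟪q, u⟫ * ⟪r, e⟫) +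
        ⟪p, u⟫ * (⟪q, e⟫ * ⟪r, m⟫ - ⟪q, m⟫ * ⟪r, e⟫)) := by
  simp only [inner3, det3]; ring

/-- Orientation lemma: vertices on a common supporting plane are turned in the same direction. -/
lemma orient3 {n : ℕ} [NeZero n] (hn : 3 ≤ n) (a : ZMod n → E3) (u : E3)
    (hu : ∀ i, 0 < ⟪u, a i⟫)
    (hli : ∀ i, LinearIndependent ℝ ![a i, a (i + 1)])
    (hcone : ∀ i j : ZMod n, i ≠ j → j ≠ i + 1 → i ≠ j + 1 → ∀ α β γ δ : ℝ, 0 ≤ α → 0 ≤ β →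
      0 ≤ γ → 0 ≤ δ → α • a i + β • a (i + 1) = γ • a j + δ • a (j + 1) →
      α • a i + β • a (i + 1) = 0)
    (hD : ∀ i, det3 (a (i - 1)) (a i) (a (i + 1)) ≠ 0)
    (m : E3) (hm : m ≠ 0) (hpos : ∀ i, 0 ≤ ⟪m, a i⟫) (j k : ZMod n) (hjk : j ≠ k)
    (hj : ⟪m, a j⟫ = 0) (hk : ⟪m, a k⟫ = 0) :
    0 < det3 (a (j - 1)) (a j) (a (j + 1)) * det3 (a (k - 1)) (a k) (a (k + 1)) := by
  set q : ZMod n → E3 := fun i => (⟪u, a i⟫)⁻¹ • a i with hq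
  have hqu : ∀ i, ⟪u, q i⟫ = 1 := fun i => by
    simp only [hq, real_inner_smul_right]; exact inv_mul_cancel₀ (hu i).ne'
  have hqm : ∀ i, 0 ≤ ⟪m, q i⟫ := fun i => by
    simp only [hq, real_inner_smul_right]; exact mul_nonneg (inv_pos.2 (hu i)).le (hpos i)
  have hqj : ⟪m, q j⟫ = 0 := by simp [hq, real_inner_smul_right, hj]
  have hqk : ⟪m, q k⟫ = 0 := by simp [hq, real_inner_smul_right, hk]
  have hdep : ∀ i, ∀ α β : ℝ, α • a i + β • a (i + 1) = 0 → α = 0 ∧ β = 0 := fun i α β h =>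
    LinearIndependent.pair_iff.1 (hli i) _ _ h
  have he : q k - q j ≠ 0 := by
    intro h
    have h' : (⟪u, a k⟫)⁻¹ • a k = (⟪u, a j⟫)⁻¹ • a j := sub_eq_zero.1 h
    have pj := inv_pos.2 (hu j)
    have pk := inv_pos.2 (hu k)
    by_cases h1 : k = j + 1
    · subst h1
      have := (hdep j (-(⟪u, a j⟫)⁻¹) ((⟪u, a (j + 1)⟫)⁻¹) (by rw [h', neg_smul]; simp)).2
      exact pk.ne' this
    by_cases h2 : j = k + 1
    · subst h2
      have := (hdep k (-(⟪u, a k⟫)⁻¹) ((⟪u, a (k + 1)⟫)⁻¹) (by rw [← h', neg_smul]; simp)).2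
      exact pj.ne' this
    have := hcone j k hjk h1 h2 (⟪u, a j⟫)⁻¹ 0 (⟪u, a k⟫)⁻¹ 0 pj.le le_rfl pk.le le_rfl
      (by rw [h', zero_smul, zero_smul])
    exact pj.ne' (hdep j _ _ this).1
  set e := q k - q j with he'
  have hdet : det3 e m u ≠ 0 := by
    apply det3_ne_of_orth he hm (p := a j) _ _ hj (hu j)
    · rw [real_inner_comm, he', inner_sub_right, hqj, hqk, sub_zero]
    · rw [real_inner_comm, he', inner_sub_right, hqu, hqu, sub_self]
  have hdetq : ∀ i, ∃ c > 0, det3 (q (i - 1)) (q i) (q (i + 1)) =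
      c * det3 (a (i - 1)) (a i) (a (i + 1)) := by
    intro i
    refine ⟨(⟪u, a (i - 1)⟫)⁻¹ * (⟪u, a i⟫)⁻¹ * (⟪u, a (i + 1)⟫)⁻¹, ?_, ?_⟩
    · have := inv_pos.2 (hu (i - 1))
      have := inv_pos.2 (hu i)
      have := inv_pos.2 (hu (i + 1))
      positivity
    · simp only [det3, hq, PiLp.smul_apply, smul_eq_mul]; ring
  have hturn : ∀ i, turnAt (fun i => ⟪q i, e⟫) (fun i => ⟪q i, m⟫) i =
      det3 (q (i - 1)) (q i) (q (i + 1)) * det3 e m u := by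
    intro i
    rw [gram_turn, real_inner_comm u (q (i - 1)), real_inner_comm u (q i),
      real_inner_comm u (q (i + 1)), hqu, hqu, hqu]
    simp only [turnAt]; ring
  have hT : ∀ i, turnAt (fun i => ⟪q i, e⟫) (fun i => ⟪q i, m⟫) i ≠ 0 := by
    intro i
    obtain ⟨c, hc, hc'⟩ := hdetq i
    rw [hturn, hc']
    exact mul_ne_zero (mul_ne_zero hc.ne' (hD i)) hdet
  have key := planar_zmod hn (fun i => ⟪q i, e⟫) (fun i => ⟪q i, m⟫) (by
      intro i j hij h1 h2 α β γ δ hα hβ hγ hδ hs hs' e1 e2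
      have hz : α • q i + β • q (i + 1) - (γ • q j + δ • q (j + 1)) = 0 := by
        apply eq_zero_of_inner3 hdet
        · simp only [inner_sub_left, inner_add_left, real_inner_smul_left]; linarith
        · simp only [inner_sub_left, inner_add_left, real_inner_smul_left]; linarith
        · rw [real_inner_comm]
          simp only [inner_sub_right, inner_add_right, real_inner_smul_right, hqu]; linarith
      have hz' := sub_eq_zero.1 hz
      simp only [hq, smul_smul] at hz'
      have := hcone i j hij h1 h2 _ _ _ _ (mul_nonneg hα (inv_pos.2 (hu _)).le)
        (mul_nonneg hβ (inv_pos.2 (hu _)).le) (mul_nonneg hγ (inv_pos.2 (hu _)).le)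
        (mul_nonneg hδ (inv_pos.2 (hu _)).le) hz'
      obtain ⟨h3, h4⟩ := hdep _ _ _ this
      have h3 := (mul_eq_zero.1 h3).resolve_right (inv_pos.2 (hu _)).ne'
      have h4 := (mul_eq_zero.1 h4).resolve_right (inv_pos.2 (hu _)).ne'
      linarith) hT (fun i => by simpa only [real_inner_comm] using hqm i) j k
    (by simpa only [real_inner_comm] using hqj) (by simpa only [real_inner_comm] using hqk) (by
      have : 0 < ⟪e, e⟫ := real_inner_self_pos.2 he
      have h2 : ⟪e, e⟫ = ⟪q k, e⟫ - ⟪q j, e⟫ := by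
        nth_rewrite 1 [he']; rw [inner_sub_left]
      linarith)
  obtain ⟨c, hc, hc'⟩ := hdetq j
  obtain ⟨c2, hc2, hc2'⟩ := hdetq k
  rw [hturn, hturn, hc', hc2'] at key
  have hfac : (c * det3 (a (j - 1)) (a j) (a (j + 1)) * det3 e m u) *
      (c2 * det3 (a (k - 1)) (a k) (a (k + 1)) * det3 e m u) =
      (c * c2 * (det3 e m u) ^ 2) *
      (det3 (a (j - 1)) (a j) (a (j + 1)) * det3 (a (k - 1)) (a k) (a (k + 1))) := by ring
  rw [hfac] at key
  exact (pos_iff_pos_of_mul_pos key).1 (by positivity)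

lemma rotate_exists {n : ℕ} [NeZero n] (μ η : ZMod n → ℝ) (hμ : ∀ k, 0 ≤ μ k)
    (hex : ∃ k, 0 < η k) (hpos : ∀ k, 0 < η k → 0 < μ k) :
    ∃ s > 0, ∃ k, 0 < η k ∧ μ k - s * η k = 0 ∧ ∀ j, 0 ≤ μ j - s * η j := by
  classical
  obtain ⟨k0, hk0⟩ := hex
  obtain ⟨k, hk, hmin⟩ := Finset.exists_min_image (Finset.univ.filter fun k => 0 < η k)
    (fun k => μ k / η k) ⟨k0, by simp [hk0]⟩
  have hk : 0 < η k := by simpa using hk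
  have hs : 0 < μ k / η k := div_pos (hpos k hk) hk
  refine ⟨μ k / η k, hs, k, hk, by field_simp; ring, fun j => ?_⟩
  rcases lt_or_ge 0 (η j) with h | h
  · have := hmin j (by simp [h])
    have := (le_div_iff₀ h).1 this
    linarith
  · have := hμ j
    nlinarith

lemma det3_cyc (p q r : E3) : det3 q r p = det3 p q r := by unfold det3; ring

lemma arc_mem {n : ℕ} [NeZero n] (a N : ZMod n → E3)
    (hN0 : ∀ i, ⟪N i, a i⟫ = 0) (hN1 : ∀ i, ⟪N i, a (i + 1)⟫ = 0)
    (c : ZMod n → ℝ) (hc : ∀ i, 0 < c i)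
    (hNc : ∀ i z, ⟪N i, z⟫ = c i * det3 (a i) (a (i + 1)) z)
    (m : E3) (hm : m ≠ 0) (hpos : ∀ i, 0 ≤ ⟪m, a i⟫) (j : ZMod n) (hj : ⟪m, a j⟫ = 0)
    (σ : ℝ) (hσ : σ * σ = 1) (hD : 0 < σ * det3 (a (j - 1)) (a j) (a (j + 1))) :
    ‖m‖⁻¹ • (σ • m) ∈ sArc (N (j - 1)) (N j) := by
  set D := det3 (a (j - 1)) (a j) (a (j + 1)) with hDd
  have hD0 : D ≠ 0 := fun h => by simp [h] at hD
  have hσ0 : σ ≠ 0 := fun h => by simp [h] at hσ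
  have e1 : ⟪N j, a (j - 1)⟫ = c j * D := by rw [hNc, det3_cyc]
  have e2 : ⟪N (j - 1), a (j + 1)⟫ = c (j - 1) * D := by rw [hNc, sub_add_cancel]
  have e3 : ⟪N (j - 1), a j⟫ = 0 := by have := hN1 (j - 1); rwa [sub_add_cancel] at this
  set s := ⟪m, a (j + 1)⟫ / (c (j - 1) * (σ * D)) with hs
  set t := ⟪m, a (j - 1)⟫ / (c j * (σ * D)) with ht
  have hs0 : 0 ≤ s := div_nonneg (hpos _) (mul_pos (hc _) hD).le
  have ht0 : 0 ≤ t := div_nonneg (hpos _) (mul_pos (hc _) hD).le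
  have hc1 := (hc (j - 1)).ne'
  have hc2 := (hc j).ne'
  have hsD : s * (c (j - 1) * D) = σ * ⟪m, a (j + 1)⟫ := by
    rw [hs]; field_simp; linear_combination (-⟪m, a (j + 1)⟫) * hσ
  have htD : t * (c j * D) = σ * ⟪m, a (j - 1)⟫ := by
    rw [ht]; field_simp; linear_combination (-⟪m, a (j - 1)⟫) * hσ
  have key : σ • m = s • N (j - 1) + t • N j := by
    have : σ • m - (s • N (j - 1) + t • N j) = 0 := by
      apply eq_zero_of_inner3 (p := a (j - 1)) (q := a j) (r := a (j + 1)) hD0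
      · simp only [inner_sub_left, inner_add_left, real_inner_smul_left]
        rw [e1, hN0, htD]; ring
      · simp only [inner_sub_left, inner_add_left, real_inner_smul_left]
        rw [e3, hN0, hj]; ring
      · simp only [inner_sub_left, inner_add_left, real_inner_smul_left]
        rw [e2, hN1, hsD]; ring
    exact sub_eq_zero.1 this
  have hσn : ‖σ‖ = 1 := by
    have : ‖σ‖ * ‖σ‖ = 1 := by rw [← norm_mul, hσ, norm_one]
    nlinarith [norm_nonneg σ]
  refine ⟨s, t, hs0, ht0, ?_, ?_⟩
  · rcases (add_nonneg hs0 ht0).lt_or_eq with h | h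
    · exact h
    · exfalso
      have h1 : s = 0 := by linarith
      have h2 : t = 0 := by linarith
      rw [h1, h2, zero_smul, zero_smul, add_zero] at key
      exact hm ((smul_eq_zero.1 key).resolve_left hσ0)
  · rw [← key, norm_smul, hσn, one_mul]

lemma supp_adj {n : ℕ} [NeZero n] (a N : ZMod n → E3)
    (hN0 : ∀ i, ⟪N i, a i⟫ = 0) (hN1 : ∀ i, ⟪N i, a (i + 1)⟫ = 0)
    (c : ZMod n → ℝ) (hc : ∀ i, 0 < c i)
    (hNc : ∀ i z, ⟪N i, z⟫ = c i * det3 (a i) (a (i + 1)) z)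
    (hor : ∀ m : E3, m ≠ 0 → (∀ i, 0 ≤ ⟪m, a i⟫) → ∀ j k, j ≠ k → ⟪m, a j⟫ = 0 → ⟪m, a k⟫ = 0 →
      0 < det3 (a (j - 1)) (a j) (a (j + 1)) * det3 (a (k - 1)) (a k) (a (k + 1)))
    (harc : ∀ i j : ZMod n, i ≠ j → j ≠ i + 1 → i ≠ j + 1 →
      sArc (N i) (N (i + 1)) ∩ sArc (N j) (N (j + 1)) = ∅)
    (m : E3) (hm : m ≠ 0) (hpos : ∀ i, 0 ≤ ⟪m, a i⟫) (j k : ZMod n) (hjk : j ≠ k)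
    (hj : ⟪m, a j⟫ = 0) (hk : ⟪m, a k⟫ = 0) : k = j + 1 ∨ j = k + 1 := by
  have h := hor m hm hpos j k hjk hj hk
  by_contra hcon
  push Not at hcon
  have hσ : ∃ σ : ℝ, σ * σ = 1 ∧ 0 < σ * det3 (a (j - 1)) (a j) (a (j + 1)) ∧
      0 < σ * det3 (a (k - 1)) (a k) (a (k + 1)) := by
    rcases mul_pos_iff.1 h with h | h
    · exact ⟨1, by norm_num, by linarith, by linarith⟩
    · exact ⟨-1, by norm_num, by linarith, by linarith⟩
  obtain ⟨σ, h1, h2, h3⟩ := hσ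
  have m1 := arc_mem a N hN0 hN1 c hc hNc m hm hpos j hj σ h1 h2
  have m2 := arc_mem a N hN0 hN1 c hc hNc m hm hpos k hk σ h1 h3
  have := harc (j - 1) (k - 1) (fun h => hjk (sub_left_injective h))
    (fun h => hcon.1 (by linear_combination h)) (fun h => hcon.2 (by linear_combination h))
  rw [sub_add_cancel, sub_add_cancel] at this
  exact (Set.eq_empty_iff_forall_notMem.1 this _) ⟨m1, m2⟩

lemma main_abs {n : ℕ} [NeZero n] (a N : ZMod n → E3) (u : E3)
    (hn1 : (1 : ZMod n) ≠ 0) (hu : ∀ i, 0 < ⟪u, a i⟫)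
    (hN0 : ∀ i, ⟪N i, a i⟫ = 0) (hN1 : ∀ i, ⟪N i, a (i + 1)⟫ = 0)
    (c : ZMod n → ℝ) (hc : ∀ i, 0 < c i)
    (hNc : ∀ i z, ⟪N i, z⟫ = c i * det3 (a i) (a (i + 1)) z)
    (hD : ∀ i, det3 (a (i - 1)) (a i) (a (i + 1)) ≠ 0)
    (hS : ∀ m : E3, m ≠ 0 → (∀ i, 0 ≤ ⟪m, a i⟫) → ∀ j k, j ≠ k → ⟪m, a j⟫ = 0 → ⟪m, a k⟫ = 0 →
      k = j + 1 ∨ j = k + 1) :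
    ∃ τ : ℝ, (τ = -1 ∨ τ = 1) ∧ ∀ i j, 0 ≤ τ * ⟪N i, a j⟫ := by
  have eP : ∀ j, ⟪N j, a (j - 1)⟫ = c j * det3 (a (j - 1)) (a j) (a (j + 1)) := fun j => by
    rw [hNc, det3_cyc]
  have eQ : ∀ j, ⟪N j, a (j + 1 + 1)⟫ =
      c j * det3 (a (j + 1 - 1)) (a (j + 1)) (a (j + 1 + 1)) := fun j => by
    rw [hNc, add_sub_cancel_right]
  have eP0 : ∀ j, ⟪N j, a (j - 1)⟫ ≠ 0 := fun j => by
    rw [eP]; exact mul_ne_zero (hc j).ne' (hD j)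
  have eQ0 : ∀ j, ⟪N j, a (j + 1 + 1)⟫ ≠ 0 := fun j => by
    rw [eQ]; exact mul_ne_zero (hc j).ne' (hD _)
  -- sign choice
  have hsg : ∀ r : ℝ, r ≠ 0 → ∃ σ : ℝ, (σ = -1 ∨ σ = 1) ∧ 0 < σ * r := by
    intro r hr
    rcases lt_or_gt_of_ne hr with h | h
    · exact ⟨-1, Or.inl rfl, by linarith⟩
    · exact ⟨1, Or.inr rfl, by linarith⟩
  -- a supporting plane containing an edge
  have hbase : ∃ m : E3, m ≠ 0 ∧ (∀ i, 0 ≤ ⟪m, a i⟫) ∧ ∃ i, ⟪m, a i⟫ = 0 ∧ ⟪m, a (i + 1)⟫ = 0 := by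
    have h1 : ∃ m : E3, m ≠ 0 ∧ (∀ i, 0 ≤ ⟪m, a i⟫) ∧ ∃ j, ⟪m, a j⟫ = 0 := by
      obtain ⟨σ, -, hσ⟩ := hsg _ (eQ0 0)
      obtain ⟨s, hs, k, hk, hk0, hall⟩ := rotate_exists (fun k => ⟪u, a k⟫)
        (fun k => σ * ⟪N 0, a k⟫) (fun k => (hu k).le) ⟨_, hσ⟩ (fun k _ => hu k)
      have hm : ∀ j, ⟪u - (s * σ) • N 0, a j⟫ = ⟪u, a j⟫ - s * (σ * ⟪N 0, a j⟫) := fun j => by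
        rw [inner_sub_left, real_inner_smul_left]; ring
      refine ⟨u - (s * σ) • N 0, ?_, fun i => by rw [hm]; exact hall i, k, by rw [hm]; exact hk0⟩
      intro h
      have h0 := hm 0
      rw [h, inner_zero_left, hN0] at h0
      have := hu 0
      linarith
    have h2 : ∃ m : E3, m ≠ 0 ∧ (∀ i, 0 ≤ ⟪m, a i⟫) ∧ ∃ j k, j ≠ k ∧ ⟪m, a j⟫ = 0 ∧ ⟪m, a k⟫ = 0 := by
      obtain ⟨m, hm0, hm, j, hj⟩ := h1
      by_cases hex : ∃ k, j ≠ k ∧ ⟪m, a k⟫ = 0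
      · obtain ⟨k, h1, h2⟩ := hex
        exact ⟨m, hm0, hm, j, k, h1, hj, h2⟩
      push Not at hex
      obtain ⟨σ, -, hσ⟩ := hsg _ (eP0 j)
      obtain ⟨s, hs, k, hk, hk0, hall⟩ := rotate_exists (fun k => ⟪m, a k⟫)
        (fun k => σ * ⟪N j, a k⟫) hm ⟨_, hσ⟩ (fun k hk => (hm k).lt_of_ne' (hex k (by
          rintro rfl
          rw [hN0] at hk; simp at hk)))
      have hm' : ∀ i, ⟪m - (s * σ) • N j, a i⟫ = ⟪m, a i⟫ - s * (σ * ⟪N j, a i⟫) := fun i => by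
        rw [inner_sub_left, real_inner_smul_left]; ring
      refine ⟨m - (s * σ) • N j, ?_, fun i => by rw [hm']; exact hall i, j, k, ?_, ?_, ?_⟩
      · intro h
        have h0 := hm' (j + 1)
        rw [h, inner_zero_left, hN1] at h0
        apply hex (j + 1)
        · intro h; apply hn1; linear_combination -h
        · linarith
      · rintro rfl
        rw [hN0] at hk; simp at hk
      · rw [hm', hN0, hj]; ring
      · rw [hm']; exact hk0
    obtain ⟨m, hm0, hm, j, k, hjk, hj, hk⟩ := h2
    rcases hS m hm0 hm j k hjk hj hk with rfl | rfl
    · exact ⟨m, hm0, hm, j, hj, hk⟩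
    · exact ⟨m, hm0, hm, k, hk, hj⟩
  -- one supporting face
  have hface : ∃ τ : ℝ, (τ = -1 ∨ τ = 1) ∧ ∃ i, ∀ j, 0 ≤ τ * ⟪N i, a j⟫ := by
    obtain ⟨m, hm0, hm, i, hi, hi1⟩ := hbase
    set r := ⟪m, a (i - 1)⟫ / ⟪N i, a (i - 1)⟫ with hr
    have hmr : m = r • N i := by
      have : m - r • N i = 0 := by
        apply eq_zero_of_inner3 (hD i)
        · rw [inner_sub_left, real_inner_smul_left, hr, div_mul_cancel₀ _ (eP0 i), sub_self]
        · rw [inner_sub_left, real_inner_smul_left, hi, hN0]; ring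
        · rw [inner_sub_left, real_inner_smul_left, hi1, hN1]; ring
      exact sub_eq_zero.1 this
    have hr0 : r ≠ 0 := by
      intro h; rw [h, zero_smul] at hmr; exact hm0 hmr
    obtain ⟨σ, h1, h2⟩ := hsg r hr0
    refine ⟨σ, h1, i, fun j => ?_⟩
    have h3 := hm j
    rw [hmr, real_inner_smul_left] at h3
    have hσσ : σ * σ = 1 := by rcases h1 with rfl | rfl <;> norm_num
    have h4 : 0 ≤ (σ * r) * (σ * ⟪N i, a j⟫) := by
      have : (σ * r) * (σ * ⟪N i, a j⟫) = r * ⟪N i, a j⟫ := by linear_combination r * ⟪N i, a j⟫ * hσσ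
      rw [this]; exact h3
    exact nonneg_of_mul_nonneg_right h4 h2
  obtain ⟨τ, hτ, i0, hi0⟩ := hface
  have hττ : τ * τ = 1 := by rcases hτ with rfl | rfl <;> norm_num
  have hτ0 : τ ≠ 0 := fun h => by simp [h] at hττ
  refine ⟨τ, hτ, ?_⟩
  have hstep : ∀ i, (∀ j, 0 ≤ τ * ⟪N i, a j⟫) → ∀ j, 0 ≤ τ * ⟪N (i + 1), a j⟫ := by
    intro i hi
    have hNi0 : N i ≠ 0 := fun h => eP0 i (by rw [h, inner_zero_left])
    have hgt : ∀ j, j ≠ i → j ≠ i + 1 → 0 < τ * ⟪N i, a j⟫ := by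
      intro j h1 h2
      refine (hi j).lt_of_ne' fun h => ?_
      have h3 := hS (τ • N i) (smul_ne_zero hτ0 hNi0)
        (fun k => by rw [real_inner_smul_left]; exact hi k) i j h1.symm
        (by rw [real_inner_smul_left, hN0, mul_zero]) (by rw [real_inner_smul_left, h])
      rcases h3 with h3 | h3
      · exact h2 h3
      · have : j = i - 1 := by rw [h3, add_sub_cancel_right]
        rw [this] at h
        exact (mul_ne_zero hτ0 (eP0 i)) h
    have hDt : 0 < τ * det3 (a (i + 1 - 1)) (a (i + 1)) (a (i + 1 + 1)) := by
      have h1 : 0 < τ * ⟪N i, a (i + 1 + 1)⟫ :=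
        (hi _).lt_of_ne' (mul_ne_zero hτ0 (eQ0 i))
      rw [eQ] at h1
      have := hc i
      refine (pos_iff_pos_of_mul_pos (?_ : 0 < c i * _)).1 this
      linarith
    have hfi : 0 < τ * ⟪N (i + 1), a i⟫ := by
      have h1 := eP (i + 1)
      have h2 : a (i + 1 - 1) = a i := by rw [add_sub_cancel_right]
      rw [h2] at h1
      rw [h2] at hDt
      rw [h1]
      have := mul_pos (hc (i + 1)) hDt
      linarith
    by_contra hcon
    push Not at hcon
    obtain ⟨k0, hk0⟩ := hcon
    obtain ⟨s, hs, k, hk, hkz, hall⟩ := rotate_exists (fun j => τ * ⟪N i, a j⟫)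
      (fun j => -(τ * ⟪N (i + 1), a j⟫)) hi ⟨k0, by linarith⟩ (fun k hk => by
        apply hgt
        · rintro rfl; linarith
        · rintro rfl; rw [hN0] at hk; simp at hk)
    have hm : ∀ j, ⟪τ • N i + (s * τ) • N (i + 1), a j⟫ =
        τ * ⟪N i, a j⟫ - s * -(τ * ⟪N (i + 1), a j⟫) := fun j => by
      rw [inner_add_left, real_inner_smul_left, real_inner_smul_left]; ring
    have h3 := hS (τ • N i + (s * τ) • N (i + 1)) (by
        intro h
        have h0 := hm i
        rw [h, inner_zero_left, hN0] at h0
        have := mul_pos hs hfi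
        linarith) (fun j => by rw [hm]; exact hall j) (i + 1) k (by
          rintro rfl; rw [hN0] at hk; simp at hk) (by rw [hm, hN0, hN1]; ring)
        (by rw [hm]; exact hkz)
    rcases h3 with h3 | h3
    · rw [h3, hN1] at hk; simp at hk
    · have : k = i := (add_right_cancel h3).symm
      rw [this] at hk; linarith
  have hind : ∀ k : ℕ, ∀ j, 0 ≤ τ * ⟪N (i0 + k), a j⟫ := by
    intro k
    induction k with
    | zero => simpa using hi0
    | succ k ih => have := hstep _ ih; simpa [add_assoc] using this
  intro i
  have := hind (i - i0).val
  simpa using this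

lemma par_of_cross3 {p q : E3} (hp : p ≠ 0) (h : cross3 p q = 0) : ∃ r : ℝ, q = r • p := by
  have c0 := cross3_0 p q
  have c1 := cross3_1 p q
  have c2 := cross3_2 p q
  rw [h] at c0 c1 c2
  simp only [PiLp.zero_apply] at c0 c1 c2
  have hpp : ⟪p, p⟫ ≠ 0 := (real_inner_self_pos.2 hp).ne'
  refine ⟨⟪p, q⟫ / ⟪p, p⟫, ?_⟩
  have key : ⟪p, p⟫ • q = ⟪p, q⟫ • p := by
    rw [inner3, inner3]
    apply ext3
    · simp only [PiLp.smul_apply, smul_eq_mul]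
      linear_combination p 1 * c2 - p 2 * c1
    · simp only [PiLp.smul_apply, smul_eq_mul]
      linear_combination p 2 * c0 - p 0 * c2
    · simp only [PiLp.smul_apply, smul_eq_mul]
      linear_combination p 0 * c1 - p 1 * c0
  rw [div_eq_inv_mul, ← smul_smul, ← key, smul_smul, inv_mul_cancel₀ hpp, one_smul]

lemma cross3_ne_zero {p q : E3} (h : LinearIndependent ℝ ![p, q]) : cross3 p q ≠ 0 := by
  intro hc
  obtain ⟨r, hr⟩ := par_of_cross3 (h.ne_zero 0 : p ≠ 0) hc
  have := (LinearIndependent.pair_iff.1 h r (-1) (by rw [hr]; simp)).2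
  norm_num at this

lemma cross3_cross3 (p q r : E3) : cross3 (cross3 p q) (cross3 q r) = det3 p q r • q := by
  apply ext3
  · simp only [PiLp.smul_apply, smul_eq_mul, cross3_0, cross3_1, cross3_2, det3]; ring
  · simp only [PiLp.smul_apply, smul_eq_mul, cross3_0, cross3_1, cross3_2, det3]; ring
  · simp only [PiLp.smul_apply, smul_eq_mul, cross3_0, cross3_1, cross3_2, det3]; ring

lemma normalize_par {p q : E3} (hq : q ≠ 0) (h : ∃ r : ℝ, q = r • p) :
    ‖q‖⁻¹ • q = ‖p‖⁻¹ • p ∨ ‖q‖⁻¹ • q = -(‖p‖⁻¹ • p) := by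
  obtain ⟨r, rfl⟩ := h
  have hr : r ≠ 0 := fun h => hq (by rw [h, zero_smul])
  rw [norm_smul, smul_smul, mul_inv, Real.norm_eq_abs]
  rcases lt_or_gt_of_ne hr with h | h
  · right
    rw [abs_of_neg h, ← neg_smul]
    congr 1
    field_simp
  · left
    rw [abs_of_pos h]
    congr 1
    field_simp

lemma face_mem_iff {n : ℕ} (v : E3) (w : ZMod n → E3) (i : ZMod n) (y : E3) :
    y ∈ starFace v w i ↔ ∃ s t : ℝ, 0 ≤ s ∧ 0 ≤ t ∧ s + t ≤ 1 ∧
      y - v = s • (w i - v) + t • (w (i + 1) - v) := by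
  unfold starFace
  rw [convexHull_insert (by simp), convexHull_pair]
  simp only [mem_convexJoin, Set.mem_singleton_iff, exists_eq_left]
  constructor
  · rintro ⟨z, ⟨b, b', hb, hb', hbb, rfl⟩, c, c', hc, hc', hcc, rfl⟩
    refine ⟨c' * b, c' * b', mul_nonneg hc' hb, mul_nonneg hc' hb', ?_, ?_⟩
    · rw [← mul_add, hbb]; linarith
    · have e1 : c = 1 - c' := by linarith
      have e2 : b = 1 - b' := by linarith
      subst e1 e2
      module
  · rintro ⟨s, t, hs, ht, hst, hy⟩
    have hy' : y = v + (s • (w i - v) + t • (w (i + 1) - v)) := by rw [← hy]; abel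
    rcases (add_nonneg hs ht).lt_or_eq with h | h
    · refine ⟨(s / (s + t)) • w i + (t / (s + t)) • w (i + 1),
        ⟨s / (s + t), t / (s + t), div_nonneg hs h.le, div_nonneg ht h.le, by
          rw [← add_div, div_self h.ne'], rfl⟩, 1 - (s + t), s + t, by linarith, h.le, by ring, ?_⟩
      rw [hy', smul_add, smul_smul, smul_smul, mul_div_cancel₀ _ h.ne', mul_div_cancel₀ _ h.ne']
      module
    · have h1 : s = 0 := by linarith
      have h2 : t = 0 := by linarith
      refine ⟨w i, left_mem_segment _ _ _, ?_⟩
      rw [hy', h1, h2]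
      simp [left_mem_segment]

lemma cone_disj {n : ℕ} (v : E3) (w : ZMod n → E3) (i j : ZMod n)
    (h : starFace v w i ∩ starFace v w j = {v}) (α β γ δ : ℝ) (hα : 0 ≤ α) (hβ : 0 ≤ β)
    (hγ : 0 ≤ γ) (hδ : 0 ≤ δ)
    (he : α • (w i - v) + β • (w (i + 1) - v) = γ • (w j - v) + δ • (w (j + 1) - v)) :
    α • (w i - v) + β • (w (i + 1) - v) = 0 := by
  set S := 1 + α + β + γ + δ with hS
  have hSp : 0 < S := by positivity
  set z := α • (w i - v) + β • (w (i + 1) - v) with hz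
  have h1 : v + S⁻¹ • z ∈ starFace v w i := by
    rw [face_mem_iff]
    refine ⟨S⁻¹ * α, S⁻¹ * β, by positivity, by positivity, ?_, ?_⟩
    · rw [← mul_add, inv_mul_le_iff₀ hSp]; linarith
    · rw [hz]; module
  have h2 : v + S⁻¹ • z ∈ starFace v w j := by
    rw [face_mem_iff]
    refine ⟨S⁻¹ * γ, S⁻¹ * δ, by positivity, by positivity, ?_, ?_⟩
    · rw [← mul_add, inv_mul_le_iff₀ hSp]; linarith
    · rw [he]; module
  have h3 : v + S⁻¹ • z ∈ ({v} : Set E3) := h ▸ ⟨h1, h2⟩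
  have h4 : S⁻¹ • z = 0 := by simpa using h3
  exact (smul_eq_zero.1 h4).resolve_left (inv_pos.2 hSp).ne'

lemma sum_zmod_range {n : ℕ} [NeZero n] (f : ZMod n → ℝ) :
    ∑ i : ZMod n, f i = ∑ k ∈ Finset.range n, f (k : ZMod n) := by
  refine Finset.sum_nbij' (fun i => i.val) (fun k => (k : ZMod n)) ?_ ?_ ?_ ?_ ?_
  · intro i _; simpa using ZMod.val_lt i
  · intro k _; simp
  · intro i _; simp
  · intro k hk; simpa using ZMod.val_cast_of_lt (Finset.mem_range.1 hk)
  · intro i _; simp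

lemma star_sign {n : ℕ} [NeZero n] (v : E3) (w : ZMod n → E3)
    (hstar : IsStar v w) (hG : GaussEmb v w) (hK : 0 < curv v w) :
    ∃ τ : ℝ, (τ = -1 ∨ τ = 1) ∧ (∀ i j, 0 ≤ τ * ⟪starUN v w i, w j - v⟫) ∧
      ∀ i, ⟪starUN v w (i + 1), w i - v⟫ ≠ 0 := by
  obtain ⟨hn, hli, himm, hemb⟩ := hstar
  set a : ZMod n → E3 := fun i => w i - v with ha
  have hn1 : (1 : ZMod n) ≠ 0 := by
    haveI : Fact (1 < n) := ⟨by omega⟩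
    exact one_ne_zero
  have hFN : ∀ i, starFN v w i ≠ 0 := fun i => cross3_ne_zero (hli i)
  have hc : ∀ i, 0 < ‖starFN v w i‖⁻¹ := fun i => inv_pos.2 (norm_pos_iff.2 (hFN i))
  have hNc : ∀ i z, ⟪starUN v w i, z⟫ = ‖starFN v w i‖⁻¹ * det3 (a i) (a (i + 1)) z := by
    intro i z
    rw [starUN, real_inner_smul_left, starFN, inner_cross3]
  have hN0 : ∀ i, ⟪starUN v w i, a i⟫ = 0 := by
    intro i; rw [hNc]; unfold det3; ring
  have hN1 : ∀ i, ⟪starUN v w i, a (i + 1)⟫ = 0 := by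
    intro i; rw [hNc]; unfold det3; ring
  have hD : ∀ i, det3 (a (i - 1)) (a i) (a (i + 1)) ≠ 0 := by
    intro i hd
    have h1 := himm (i - 1)
    have h2 : cross3 (starFN v w (i - 1)) (starFN v w i) = 0 := by
      unfold starFN
      rw [sub_add_cancel, cross3_cross3]
      have : det3 (w (i - 1) - v) (w i - v) (w (i + 1) - v) = 0 := hd
      rw [this, zero_smul]
    rw [sub_add_cancel] at h1
    rcases normalize_par (hFN i) (par_of_cross3 (hFN (i - 1)) h2) with h | h
    · exact h1.1 h
    · exact h1.2 h
  obtain ⟨u, hu'⟩ := hemisphere (fun k : ℕ => a (k : ZMod n)) n (by simp)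
    (fun k => by have := hli (k : ZMod n); simpa [ha] using this) (by
      have := hK
      unfold curv at this
      rw [sum_zmod_range] at this
      simp only [Nat.cast_add, Nat.cast_one, ha]
      linarith)
  have hu : ∀ i, 0 < ⟪u, a i⟫ := fun i => by simpa using hu' i.val (ZMod.val_lt i)
  have hcone : ∀ i j : ZMod n, i ≠ j → j ≠ i + 1 → i ≠ j + 1 → ∀ α β γ δ : ℝ, 0 ≤ α → 0 ≤ β →
      0 ≤ γ → 0 ≤ δ → α • a i + β • a (i + 1) = γ • a j + δ • a (j + 1) →
      α • a i + β • a (i + 1) = 0 := fun i j h1 h2 h3 α β γ δ hα hβ hγ hδ he =>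
    cone_disj v w i j ((hemb i j h1).2.2 h2 h3) α β γ δ hα hβ hγ hδ he
  have hor := orient3 hn a u hu hli hcone hD
  obtain ⟨τ, h1, h2⟩ := main_abs a (starUN v w) u hn1 hu hN0 hN1 _ hc hNc hD
    (fun m hm hp j k hjk hj hk => supp_adj a (starUN v w) hN0 hN1 _ hc hNc hor
      (fun i j h1 h2 h3 => (hG.2 i j h1).2.2 h2 h3) m hm hp j k hjk hj hk)
  refine ⟨τ, h1, h2, fun i => ?_⟩
  have h3 := hNc (i + 1) (a i)
  have h4 := hD (i + 1)
  rw [add_sub_cancel_right] at h4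
  rw [det3_cyc] at h3
  have : ⟪starUN v w (i + 1), w i - v⟫ = _ := h3
  rw [this]
  exact mul_ne_zero (hc _).ne' h4

/-- Proposition 2.16, simplicial case: for an embedded, immersed simplicial vertex star
with non-self-intersecting Gauss image and positive discrete Gaussian curvature, every
point `x = Σᵢ λᵢ nᵢ` (all `λᵢ > 0`) of the open convex cone spanned by the face normals
defines a supporting tangent plane through `v`: all neighbor vertices lie strictly on one
side of the plane `{y : ⟨y − v, x⟩ = 0}`, the plane meets the carrier exactly in `{v}`,
and the rest of the carrier lies in one open half-space. -/
theorem stmt7 {n : ℕ} [NeZero n] (v : E3) (w : ZMod n → E3)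
    (hstar : IsStar v w) (hG : GaussEmb v w) (hK : 0 < curv v w)
    (lam : ZMod n → ℝ) (hlam : ∀ i, 0 < lam i)
    (x : E3) (hx : x = ∑ i : ZMod n, lam i • starUN v w i) :
    ∃ ε : ℝ, (ε = -1 ∨ ε = 1) ∧
      (∀ j : ZMod n, 0 < ε * ⟪w j - v, x⟫) ∧
      ({y : E3 | ⟪y - v, x⟫ = 0} ∩ starCarrier v w = {v}) ∧
      (∀ y ∈ starCarrier v w, y ≠ v → 0 < ε * ⟪y - v, x⟫) := by
  obtain ⟨τ, hτ, hall, hne⟩ := star_sign v w hstar hG hK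
  have hτ0 : τ ≠ 0 := by rcases hτ with rfl | rfl <;> norm_num
  have hvert : ∀ j : ZMod n, 0 < τ * ⟪w j - v, x⟫ := by
    intro j
    rw [hx, inner_sum, Finset.mul_sum]
    refine Finset.sum_pos' (fun i _ => ?_) ⟨j + 1, Finset.mem_univ _, ?_⟩
    · rw [real_inner_smul_right, real_inner_comm, mul_left_comm]
      exact mul_nonneg (hlam i).le (hall i j)
    · rw [real_inner_smul_right, real_inner_comm, mul_left_comm]
      exact mul_pos (hlam _) ((hall (j + 1) j).lt_of_ne' (mul_ne_zero hτ0 (hne j)))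
  have hcar : ∀ y ∈ starCarrier v w, y ≠ v → 0 < τ * ⟪y - v, x⟫ := by
    intro y hy hyv
    obtain ⟨i, hi⟩ := Set.mem_iUnion.1 hy
    obtain ⟨s, t, hs, ht, -, he⟩ := (face_mem_iff v w i y).1 hi
    have e : τ * ⟪y - v, x⟫ = s * (τ * ⟪w i - v, x⟫) + t * (τ * ⟪w (i + 1) - v, x⟫) := by
      rw [he, inner_add_left, real_inner_smul_left, real_inner_smul_left]; ring
    rw [e]
    have h1 := hvert i
    have h2 := hvert (i + 1)
    rcases hs.lt_or_eq with h | h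
    · exact add_pos_of_pos_of_nonneg (mul_pos h h1) (mul_nonneg ht h2.le)
    · rcases ht.lt_or_eq with h' | h'
      · exact add_pos_of_nonneg_of_pos (mul_nonneg hs h1.le) (mul_pos h' h2)
      · exfalso
        rw [← h, ← h', zero_smul, zero_smul, add_zero] at he
        exact hyv (sub_eq_zero.1 he)
  refine ⟨τ, hτ, hvert, ?_, hcar⟩
  ext y
  simp only [Set.mem_inter_iff, Set.mem_setOf_eq, Set.mem_singleton_iff]
  constructor
  · rintro ⟨h0, hy⟩
    by_contra hyv
    have := hcar y hy hyv
    rw [h0, mul_zero] at this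
    exact lt_irrefl _ this
  · rintro rfl
    refine ⟨by simp, Set.mem_iUnion.2 ⟨0, ?_⟩⟩
    exact (face_mem_iff y w 0 y).2 ⟨0, 0, le_rfl, le_rfl, by norm_num, by simp⟩
end
end
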